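/- arXiv:1712.05549 — 2 statements merged into one kernel-verified Lean document; each statement's English description precedes it below -/
import Mathlib

section
/- Let d = 4. There exists a constant C > 0 such that for every finite field F of odd characteristic, every nontrivial additive character e of F, and every function f : P → ℂ on the paraboloid P ⊆ F^4, one has ‖(f dσ)^∨‖_{L^{28/9}(F^4)} ≤ C ‖f‖_{L^2(P,dσ)}. -/
open Finset

/-- The finite field extension operator for the paraboloid
`P = {(x̄, x̄·x̄) : x̄ ∈ F^{d-1}} ⊆ F^d` (here `d = 4`), where a point of `F^d` is modeled
as a pair `(x̄, x_d) ∈ F^{d-1} × F` and a function on `P` is parameterized by `x̄`: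
`(f dσ)^∨(x) = |F|^{-(d-1)} ∑_{ξ ∈ P} f(ξ) e(x·ξ)`. -/
noncomputable def extOp {F : Type} [Field F] [Fintype F] {d : ℕ} (e : AddChar F ℂ)
    (f : (Fin (d - 1) → F) → ℂ) (x : (Fin (d - 1) → F) × F) : ℂ :=
  ((Fintype.card F : ℂ) ^ (d - 1))⁻¹ *
    ∑ y : Fin (d - 1) → F, f y * e (∑ i, x.1 i * y i + x.2 * ∑ i, y i * y i)

section Geometry

variable {F : Type} [Field F]

lemma exists_dotProduct_coordinates {v : Fin 3 → F} (hv : v ≠ 0) :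
    ∃ i j k : Fin 3, (∀ x y : Fin 3 → F, x ⬝ᵥ y = x i * y i + x j * y j + x k * y k) ∧
      (∀ l, l = i ∨ l = j ∨ l = k) ∧ v k ≠ 0 := by
  obtain ⟨k, hk⟩ := Function.ne_iff.1 hv
  fin_cases k
  · exact ⟨1, 2, 0, fun x y => by simp [dotProduct, Fin.sum_univ_three]; ring, by decide, hk⟩
  · exact ⟨0, 2, 1, fun x y => by simp [dotProduct, Fin.sum_univ_three]; ring, by decide, hk⟩
  · exact ⟨0, 1, 2, fun x y => by simp [dotProduct, Fin.sum_univ_three], by decide, hk⟩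

lemma quadratic_coeff_ne_zero (h2 : (2 : F) ≠ 0) {c : F} (hc : c ≠ 0) (a b : F) :
    c ^ 2 + a ^ 2 ≠ 0 ∨ c ^ 2 + b ^ 2 ≠ 0 ∨ 2 * a * b ≠ 0 := by
  by_contra! h
  obtain ⟨h1, h3, h4⟩ := h
  have hab : a * b = 0 := by
    rw [mul_assoc] at h4
    exact (mul_eq_zero.1 h4).resolve_left h2
  have : c ^ 2 * c ^ 2 = 0 := by
    linear_combination (c ^ 2) * h1 - a ^ 2 * h3 + a * b * hab
  simp [hc] at this

lemma orthogonal_of_energy (h2 : (2 : F) ≠ 0) {a b c d : Fin 3 → F} (h : a + b = c + d)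
    (h' : a ⬝ᵥ a + b ⬝ᵥ b = c ⬝ᵥ c + d ⬝ᵥ d) : (a - c) ⬝ᵥ (b - c) = 0 := by
  obtain rfl : d = a + b - c := by rw [h]; abel
  apply mul_left_cancel₀ h2
  simp only [dotProduct, Fin.sum_univ_three, Pi.sub_apply, Pi.add_apply] at h' ⊢
  linear_combination -h'

variable [Fintype F] [DecidableEq F]

lemma card_filter_quadratic_left_le {a : F} (b c : F) (ha : a ≠ 0) :
    #{p : F × F | a * p.1 ^ 2 + b * p.1 * p.2 + c * p.2 ^ 2 = 0} ≤ 2 * Fintype.card F := by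
  refine card_le_mul_card_image_of_maps_to (f := Prod.snd) (t := (univ : Finset F))
    (fun _ _ => mem_univ _) 2 ?_
  intro y _
  rcases Finset.eq_empty_or_nonempty
    ({p ∈ ({p : F × F | a * p.1 ^ 2 + b * p.1 * p.2 + c * p.2 ^ 2 = 0} : Finset (F × F)) |
      p.2 = y}) with h | ⟨⟨x₀, y₀⟩, h₀⟩
  · rw [h]; simp
  · simp only [mem_filter, mem_univ, true_and] at h₀
    obtain ⟨h₀, rfl⟩ := h₀
    refine (card_le_card (t := {(x₀, y₀), (-x₀ - b * y₀ / a, y₀)}) ?_).trans card_le_two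
    rintro ⟨x, y⟩ hx
    simp only [mem_filter, mem_univ, true_and] at hx
    obtain ⟨hx, rfl⟩ := hx
    have : (x - x₀) * (a * (x + x₀) + b * y) = 0 := by linear_combination hx - h₀
    simp only [mem_insert, mem_singleton, Prod.mk.injEq, and_true]
    rcases mul_eq_zero.1 this with h | h
    · exact Or.inl (sub_eq_zero.1 h)
    · right
      field_simp
      linear_combination h

lemma card_filter_quadratic_le {a b c : F} (h : a ≠ 0 ∨ c ≠ 0 ∨ b ≠ 0) :
    #{p : F × F | a * p.1 ^ 2 + b * p.1 * p.2 + c * p.2 ^ 2 = 0} ≤ 2 * Fintype.card F := by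
  by_cases ha : a ≠ 0
  · exact card_filter_quadratic_left_le b c ha
  by_cases hc : c ≠ 0
  · refine le_trans ?_ (card_filter_quadratic_left_le b a hc)
    refine card_le_card_of_injOn Prod.swap ?_ (Prod.swap_injective.injOn)
    rintro ⟨x, y⟩ hx
    simp only [coe_filter, mem_univ, true_and, Set.mem_ofPred_eq, Prod.swap_prod_mk] at hx ⊢
    linear_combination hx
  push Not at ha hc
  have hb : b ≠ 0 := by tauto
  subst ha hc
  refine (card_le_card (t := univ.image (fun y : F => ((0 : F), y)) ∪
    univ.image (fun x : F => (x, (0 : F)))) ?_).trans ?_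
  · rintro ⟨x, y⟩ hx
    simp only [mem_filter, mem_univ, true_and, zero_mul, zero_add, add_zero, mul_eq_zero, hb,
      false_or] at hx
    rcases hx with rfl | rfl <;> simp
  · refine (card_union_le _ _).trans ?_
    rw [two_mul]
    exact add_le_add card_image_le card_image_le

lemma card_isotropic_orthogonal_le (h2 : (2 : F) ≠ 0) {v : Fin 3 → F} (hv : v ≠ 0) :
    #{u : Fin 3 → F | u ⬝ᵥ u = 0 ∧ u ⬝ᵥ v = 0} ≤ 2 * Fintype.card F := by
  obtain ⟨i, j, k, hdot, hl, hk⟩ := exists_dotProduct_coordinates hv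
  refine le_trans (card_le_card_of_injOn (fun u => (u i, u j)) ?_ ?_)
    (card_filter_quadratic_le (quadratic_coeff_ne_zero h2 hk (v i) (v j)))
  · intro u hu
    simp only [coe_filter, mem_univ, true_and, Set.mem_ofPred_eq, hdot] at hu ⊢
    linear_combination v k ^ 2 * hu.1 - (u k * v k - (u i * v i + u j * v j)) * hu.2
  · intro u hu w hw huw
    simp only [coe_filter, mem_univ, true_and, Set.mem_ofPred_eq, hdot, Prod.mk.injEq]
      at hu hw huw
    have h3 : u k = w k := by
      apply mul_right_cancel₀ hk
      linear_combination hu.2 - hw.2 - v i * huw.1 - v j * huw.2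
    funext l
    rcases hl l with rfl | rfl | rfl
    exacts [huw.1, huw.2, h3]

lemma card_dotProduct_eq_one {b : Fin 3 → F} (hb : b ≠ 0) :
    #{v : Fin 3 → F | v ⬝ᵥ b = 1} = Fintype.card F ^ 2 := by
  obtain ⟨k, hk⟩ := Function.ne_iff.1 hb
  have htrans (s : F) : #{v : Fin 3 → F | v ⬝ᵥ b = s} = #{v : Fin 3 → F | v ⬝ᵥ b = 1} := by
    have hw : Pi.single k ((1 - s) / b k) ⬝ᵥ b = 1 - s := by
      rw [single_dotProduct, div_mul_cancel₀ _ hk]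
    refine card_bij' (fun v _ => v + Pi.single k ((1 - s) / b k))
      (fun v _ => v - Pi.single k ((1 - s) / b k)) ?_ ?_ (by simp) (by simp)
    · intro v hv
      simp only [mem_filter, mem_univ, true_and, add_dotProduct, hw] at hv ⊢
      rw [hv]; ring
    · intro v hv
      simp only [mem_filter, mem_univ, true_and, sub_dotProduct, hw] at hv ⊢
      rw [hv]; ring
  have hsum := card_eq_sum_card_fiberwise (s := (univ : Finset (Fin 3 → F))) (t := univ)
    (f := fun v => v ⬝ᵥ b) (fun _ _ => by simp)
  simp only [htrans, sum_const, card_univ, Fintype.card_pi, prod_const, Fintype.card_fin,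
    smul_eq_mul] at hsum
  have hq : 0 < Fintype.card F := Fintype.card_pos
  rw [pow_succ', Nat.mul_right_inj hq.ne'] at hsum
  exact hsum.symm

lemma card_dotProduct_eq_one_inter_le {b c : Fin 3 → F} (hbc : b ≠ c) :
    #{v : Fin 3 → F | v ⬝ᵥ b = 1 ∧ v ⬝ᵥ c = 1} ≤ Fintype.card F := by
  have key : ∀ i j k : Fin 3, (∀ x y : Fin 3 → F, x ⬝ᵥ y = x i * y i + x j * y j + x k * y k) →
      (∀ l, l = i ∨ l = j ∨ l = k) → b i * c j - b j * c i ≠ 0 →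
      #{v : Fin 3 → F | v ⬝ᵥ b = 1 ∧ v ⬝ᵥ c = 1} ≤ Fintype.card F := by
    intro i j k hdot hl hk
    refine (card_le_card_of_injOn (t := univ) (fun u => u k) (fun _ _ => by simp) ?_).trans
      (by simp)
    intro u hu w hw huw
    simp only [coe_filter, mem_univ, true_and, Set.mem_ofPred_eq, hdot] at hu hw huw
    have h1 : u i = w i := by
      apply mul_right_cancel₀ hk
      linear_combination c j * (hu.1 - hw.1) - b j * (hu.2 - hw.2)
        - (b k * c j - b j * c k) * huw
    have h3 : u j = w j := by
      apply mul_right_cancel₀ hk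
      linear_combination - c i * (hu.1 - hw.1) + b i * (hu.2 - hw.2)
        - (b i * c k - b k * c i) * huw
    funext l
    rcases hl l with rfl | rfl | rfl
    exacts [h1, h3, huw]
  by_cases h01 : b 0 * c 1 - b 1 * c 0 ≠ 0
  · exact key 0 1 2 (fun x y => by simp [dotProduct, Fin.sum_univ_three]) (by decide) h01
  by_cases h02 : b 0 * c 2 - b 2 * c 0 ≠ 0
  · exact key 0 2 1 (fun x y => by simp [dotProduct, Fin.sum_univ_three]; ring) (by decide) h02
  by_cases h12 : b 1 * c 2 - b 2 * c 1 ≠ 0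
  · exact key 1 2 0 (fun x y => by simp [dotProduct, Fin.sum_univ_three]; ring) (by decide) h12
  push Not at h01 h02 h12
  rw [card_eq_zero.2]
  · exact Nat.zero_le _
  rw [filter_eq_empty_iff]
  rintro v - ⟨hb, hc⟩
  simp only [dotProduct, Fin.sum_univ_three] at hb hc
  apply hbc
  funext l
  fin_cases l <;> simp only [Fin.zero_eta, Fin.mk_one, Fin.reduceFinMk]
  · linear_combination c 0 * hb - b 0 * hc + v 1 * h01 + v 2 * h02
  · linear_combination c 1 * hb - b 1 * hc - v 0 * h01 + v 2 * h12
  · linear_combination c 2 * hb - b 2 * hc - v 0 * h02 - v 1 * h12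

lemma sum_sq_card_dotProduct_eq_one_sub_le (A : Finset (Fin 3 → F)) :
    ∑ v : Fin 3 → F, ((#{b ∈ A | v ⬝ᵥ b = 1} : ℝ) - #A / Fintype.card F) ^ 2
      ≤ 3 * Fintype.card F ^ 2 * #A := by
  set q : ℝ := (Fintype.card F : ℝ) with hq
  have hq1 : 1 ≤ q := Nat.one_le_cast.2 Fintype.card_pos
  have hk (v : Fin 3 → F) :
      (#{b ∈ A | v ⬝ᵥ b = 1} : ℝ) = ∑ b ∈ A, if v ⬝ᵥ b = 1 then 1 else 0 := by
    rw [card_filter]; push_cast; rfl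
  have hsq : ∑ v : Fin 3 → F, (#{b ∈ A | v ⬝ᵥ b = 1} : ℝ) ^ 2
      ≤ #A * q ^ 2 + (#A : ℝ) ^ 2 * q := by
    calc ∑ v : Fin 3 → F, (#{b ∈ A | v ⬝ᵥ b = 1} : ℝ) ^ 2
        = ∑ b ∈ A, ∑ c ∈ A, (#{v : Fin 3 → F | v ⬝ᵥ b = 1 ∧ v ⬝ᵥ c = 1} : ℝ) := by
          simp_rw [hk, sq, sum_mul_sum, card_filter]
          rw [sum_comm]
          refine sum_congr rfl fun b _ => ?_
          rw [sum_comm]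
          refine sum_congr rfl fun c _ => ?_
          push_cast
          refine sum_congr rfl fun v _ => ?_
          rw [ite_and, ← ite_and, mul_ite, mul_one, mul_zero]
          split_ifs <;> simp_all
      _ ≤ ∑ b ∈ A, ∑ c ∈ A, ((if b = c then q ^ 2 else 0) + q) := by
          refine sum_le_sum fun b _ => sum_le_sum fun c _ => ?_
          split_ifs with h
          · subst h
            simp only [and_self]
            by_cases hb : b = 0
            · simp [hb]; positivity
            · rw [card_dotProduct_eq_one hb]; push_cast; linarith
          · rw [zero_add]
            exact Nat.cast_le.2 (card_dotProduct_eq_one_inter_le h)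
      _ = #A * q ^ 2 + (#A : ℝ) ^ 2 * q := by
          simp only [sum_add_distrib, sum_ite_eq, sum_const, nsmul_eq_mul]
          rw [sum_ite_mem, inter_self, sum_const, nsmul_eq_mul]
          ring
  have hsum : q ^ 2 * #A - q ^ 2 ≤ ∑ v : Fin 3 → F, (#{b ∈ A | v ⬝ᵥ b = 1} : ℝ) := by
    calc q ^ 2 * #A - q ^ 2 ≤ ∑ b ∈ A, (q ^ 2 - if b = 0 then q ^ 2 else 0) := by
          rw [sum_sub_distrib, sum_const, nsmul_eq_mul, sum_ite_eq']
          split_ifs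
          · linarith
          · nlinarith
      _ ≤ ∑ b ∈ A, (#{v : Fin 3 → F | v ⬝ᵥ b = 1} : ℝ) := by
          refine sum_le_sum fun b _ => ?_
          split_ifs with hb
          · simp
          · rw [card_dotProduct_eq_one hb]; simp [hq]
      _ = ∑ v : Fin 3 → F, (#{b ∈ A | v ⬝ᵥ b = 1} : ℝ) := by
          simp_rw [hk]
          rw [sum_comm]
          refine sum_congr rfl fun b _ => ?_
          rw [card_filter]; push_cast; rfl
  have hN : (0 : ℝ) ≤ #A := by positivity
  calc ∑ v : Fin 3 → F, ((#{b ∈ A | v ⬝ᵥ b = 1} : ℝ) - #A / q) ^ 2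
      = ∑ v : Fin 3 → F, (#{b ∈ A | v ⬝ᵥ b = 1} : ℝ) ^ 2
        - 2 * (#A / q) * ∑ v : Fin 3 → F, (#{b ∈ A | v ⬝ᵥ b = 1} : ℝ) + q ^ 3 * (#A / q) ^ 2 := by
        rw [mul_sum, ← sum_sub_distrib]
        have : q ^ 3 * (#A / q) ^ 2 = ∑ v : Fin 3 → F, (#A / q) ^ 2 := by
          simp [hq]
        rw [this, ← sum_add_distrib]
        exact sum_congr rfl fun v _ => by ring
    _ ≤ (#A * q ^ 2 + (#A : ℝ) ^ 2 * q) - 2 * (#A / q) * (q ^ 2 * #A - q ^ 2)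
        + q ^ 3 * (#A / q) ^ 2 := by gcongr
    _ = #A * q ^ 2 + 2 * q * #A := by field_simp; ring
    _ ≤ 3 * q ^ 2 * #A := by
        nlinarith [mul_nonneg hN (mul_nonneg (by linarith : 0 ≤ q) (sub_nonneg.2 hq1))]

lemma sum_sq_card_inversion_sub_le (A : Finset (Fin 3 → F)) :
    ∑ c : Fin 3 → F with c ⬝ᵥ c ≠ 0,
        ((#{b ∈ A | c ⬝ᵥ b = c ⬝ᵥ c} : ℝ) - #A / Fintype.card F) ^ 2
      ≤ 3 * Fintype.card F ^ 2 * #A := by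
  refine le_trans ?_ (sum_sq_card_dotProduct_eq_one_sub_le A)
  have hinj : Set.InjOn (fun c : Fin 3 → F => (c ⬝ᵥ c)⁻¹ • c)
      (({c | c ⬝ᵥ c ≠ 0} : Finset (Fin 3 → F)) : Set (Fin 3 → F)) := by
    intro c hc d hd hcd
    simp only [coe_filter, mem_univ, true_and, Set.mem_ofPred_eq] at hc hd hcd
    have h1 : (c ⬝ᵥ c)⁻¹ = (d ⬝ᵥ d)⁻¹ := by
      have := congrArg (fun w => w ⬝ᵥ w) hcd
      simpa [hc, hd] using this
    rw [h1] at hcd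
    exact smul_right_injective _ (inv_ne_zero hd) hcd
  calc ∑ c : Fin 3 → F with c ⬝ᵥ c ≠ 0,
        ((#{b ∈ A | c ⬝ᵥ b = c ⬝ᵥ c} : ℝ) - #A / Fintype.card F) ^ 2
      = ∑ c : Fin 3 → F with c ⬝ᵥ c ≠ 0,
        ((#{b ∈ A | ((c ⬝ᵥ c)⁻¹ • c) ⬝ᵥ b = 1} : ℝ) - #A / Fintype.card F) ^ 2 := by
        refine sum_congr rfl fun c hc => ?_
        have hc : c ⬝ᵥ c ≠ 0 := by simpa using hc
        simp_rw [smul_dotProduct, smul_eq_mul, inv_mul_eq_one₀ hc, eq_comm]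
    _ = ∑ v ∈ ({c | c ⬝ᵥ c ≠ 0} : Finset (Fin 3 → F)).image (fun c => (c ⬝ᵥ c)⁻¹ • c),
        ((#{b ∈ A | v ⬝ᵥ b = 1} : ℝ) - #A / Fintype.card F) ^ 2 := by
        rw [sum_image hinj]
    _ ≤ _ := sum_le_sum_of_subset_of_nonneg (subset_univ _) fun _ _ _ => sq_nonneg _

lemma sum_sq_card_orthogonal_sub_le (A : Finset (Fin 3 → F)) (a : Fin 3 → F) :
    ∑ c : Fin 3 → F with (a - c) ⬝ᵥ (a - c) ≠ 0,
        ((#{b ∈ A | (a - c) ⬝ᵥ (b - c) = 0} : ℝ) - #A / Fintype.card F) ^ 2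
      ≤ 3 * Fintype.card F ^ 2 * #A := by
  have h := sum_sq_card_inversion_sub_le (A.image fun b => a - b)
  rw [card_image_of_injective _ (sub_right_injective (b := a))] at h
  refine le_of_eq_of_le ?_ h
  refine sum_bij' (fun c _ => a - c) (fun c _ => a - c) (by simp)
    (by intro c hc; simpa only [mem_filter, mem_univ, true_and, sub_sub_cancel] using hc)
    (by simp) (by simp) ?_
  intro c _
  rw [filter_image, card_image_of_injective _ (sub_right_injective (b := a))]
  congr 4
  ext b
  rw [mem_filter, mem_filter, and_congr_right_iff]
  intro _
  rw [show b - c = (a - c) - (a - b) by abel, dotProduct_sub, sub_eq_zero, eq_comm]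

/-- Right angles `(a, b, c)` at `c` whose leg `a - c` is not isotropic. -/
lemma sum_card_orthogonal_le (A : Finset (Fin 3 → F)) :
    ∑ a ∈ A, ∑ c ∈ A with (a - c) ⬝ᵥ (a - c) ≠ 0, (#{b ∈ A | (a - c) ⬝ᵥ (b - c) = 0} : ℝ)
      ≤ #A ^ 3 / Fintype.card F + 4 * Fintype.card F * #A ^ 2 := by
  set q : ℝ := (Fintype.card F : ℝ) with hq
  have hq1 : 1 ≤ q := Nat.one_le_cast.2 Fintype.card_pos
  have hx (x m : ℝ) : x ≤ (m + q) + (x - m) ^ 2 / q := by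
    have : 0 ≤ ((x - m) ^ 2 - (x - m) * q + q ^ 2) / q :=
      div_nonneg (by nlinarith [sq_nonneg (x - m - q / 2)]) (by linarith)
    have h2 : ((x - m) ^ 2 - (x - m) * q + q ^ 2) / q = (x - m) ^ 2 / q - (x - m) + q := by
      field_simp
    linarith
  calc _ ≤ ∑ a ∈ A, (#A * (#A / q + q) + 3 * q ^ 2 * #A / q) := by
        refine sum_le_sum fun a _ => ?_
        refine (sum_le_sum fun c _ => hx _ (#A / q)).trans ?_
        rw [sum_add_distrib, sum_const, nsmul_eq_mul, ← sum_div]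
        gcongr
        · exact filter_subset _ _
        · refine le_trans ?_ (sum_sq_card_orthogonal_sub_le A a)
          exact sum_le_sum_of_subset_of_nonneg (filter_subset_filter _ (subset_univ _))
            fun _ _ _ => sq_nonneg _
    _ = _ := by
        rw [sum_const, nsmul_eq_mul]
        field_simp
        ring

/-- The additive energy of the lift of `A` to the paraboloid. -/
def paraboloidEnergy (A : Finset (Fin 3 → F)) : ℕ :=
  #{p ∈ (A ×ˢ A) ×ˢ (A ×ˢ A) | p.1.1 + p.1.2 = p.2.1 + p.2.2 ∧
    p.1.1 ⬝ᵥ p.1.1 + p.1.2 ⬝ᵥ p.1.2 = p.2.1 ⬝ᵥ p.2.1 + p.2.2 ⬝ᵥ p.2.2}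

lemma paraboloidEnergy_le (h2 : (2 : F) ≠ 0) (A : Finset (Fin 3 → F)) :
    (paraboloidEnergy A : ℝ) ≤ #A ^ 3 / Fintype.card F + 7 * Fintype.card F * #A ^ 2 := by
  set q : ℝ := (Fintype.card F : ℝ) with hq
  have hq1 : 1 ≤ q := Nat.one_le_cast.2 Fintype.card_pos
  set S₁ : Finset ((Fin 3 → F) × (Fin 3 → F) × (Fin 3 → F)) :=
    {p ∈ A ×ˢ A ×ˢ A | (p.1 - p.2.1) ⬝ᵥ (p.1 - p.2.1) ≠ 0 ∧
      (p.1 - p.2.1) ⬝ᵥ (p.2.2 - p.2.1) = 0} with hS₁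
  set S₂ : Finset ((Fin 3 → F) × (Fin 3 → F) × (Fin 3 → F)) :=
    {p ∈ univ ×ˢ A ×ˢ A | p.2.2 ≠ p.2.1 ∧ (p.1 - p.2.1) ⬝ᵥ (p.1 - p.2.1) = 0 ∧
      (p.1 - p.2.1) ⬝ᵥ (p.2.2 - p.2.1) = 0} with hS₂
  set S₃ : Finset ((Fin 3 → F) × (Fin 3 → F) × (Fin 3 → F)) :=
    (A ×ˢ A).image fun p => (p.1, p.2, p.2) with hS₃
  have hle : paraboloidEnergy A ≤ #(S₁ ∪ (S₂ ∪ S₃)) := by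
    refine card_le_card_of_injOn (fun p => (p.1.1, p.2.1, p.1.2)) ?_ ?_
    · rintro ⟨⟨a, b⟩, c, d⟩ hp
      simp only [coe_filter, mem_product, Set.mem_ofPred_eq] at hp
      obtain ⟨⟨⟨ha, hb⟩, hc, hd⟩, hadd, hsq⟩ := hp
      have horth := orthogonal_of_energy h2 hadd hsq
      simp only [coe_union, Set.mem_union, mem_coe, hS₁, hS₂, hS₃, mem_filter, mem_product,
        mem_univ, true_and, mem_image, Prod.mk.injEq, Prod.exists]
      by_cases h1 : (a - c) ⬝ᵥ (a - c) = 0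
      · by_cases hbc : b = c
        · exact Or.inr (Or.inr ⟨a, c, ⟨ha, hc⟩, rfl, rfl, hbc.symm⟩)
        · exact Or.inr (Or.inl ⟨⟨hc, hb⟩, hbc, h1, horth⟩)
      · exact Or.inl ⟨⟨ha, hc, hb⟩, h1, horth⟩
    · rintro ⟨⟨a, b⟩, c, d⟩ hp ⟨⟨a', b'⟩, c', d'⟩ hp' h
      simp only [coe_filter, mem_product, Set.mem_ofPred_eq, Prod.mk.injEq] at hp hp' h
      obtain ⟨rfl, rfl, rfl⟩ := h
      have : d = d' := add_left_cancel (hp.2.1.symm.trans hp'.2.1)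
      rw [this]
  have h₁ : (#S₁ : ℝ) ≤ #A ^ 3 / q + 4 * q * #A ^ 2 := by
    refine le_of_eq_of_le ?_ (sum_card_orthogonal_le A)
    simp only [hS₁, card_filter, sum_product, sum_filter]
    push_cast
    refine sum_congr rfl fun a _ => sum_congr rfl fun c _ => ?_
    by_cases h : (a - c) ⬝ᵥ (a - c) = 0 <;>
      simp only [h, ne_eq, not_true_eq_false, not_false_eq_true, false_and, true_and, if_true,
        if_false, sum_const_zero]
  have h₂ : #S₂ ≤ #A ^ 2 * (2 * Fintype.card F) := by
    rw [mul_comm]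
    refine (card_le_mul_card_image_of_maps_to (f := Prod.snd) (t := A ×ˢ A) ?_
      (2 * Fintype.card F) ?_).trans (by rw [card_product, sq])
    · intro p hp
      exact (mem_product.1 (mem_filter.1 hp).1).2
    · rintro ⟨c, b⟩ -
      by_cases hbc : b = c
      · rw [card_eq_zero.2]
        · exact Nat.zero_le _
        rw [filter_eq_empty_iff]
        rintro ⟨a, c', b'⟩ hp h
        simp only [Prod.mk.injEq] at h
        simp only [hS₂, mem_filter] at hp
        exact hp.2.1 (by rw [h.1, h.2, hbc])
      · refine le_trans ?_ (card_isotropic_orthogonal_le h2 (sub_ne_zero.2 hbc))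
        refine card_le_card_of_injOn (fun p => p.1 - c) ?_ ?_
        · rintro ⟨a, c', b'⟩ hp
          simp only [hS₂, coe_filter, mem_filter, Set.mem_ofPred_eq, Prod.mk.injEq] at hp
          obtain ⟨⟨-, -, h3, h4⟩, rfl, rfl⟩ := hp
          exact mem_coe.2 (mem_filter.2 ⟨mem_univ _, h3, h4⟩)
        · rintro ⟨a, c', b'⟩ hp ⟨a', c'', b''⟩ hp' h
          simp only [coe_filter, Set.mem_ofPred_eq, Prod.mk.injEq] at hp hp' h
          obtain ⟨-, rfl, rfl⟩ := hp
          obtain ⟨-, rfl, rfl⟩ := hp'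
          simpa using h
  have h₃ : #S₃ ≤ #A ^ 2 := card_image_le.trans (by rw [card_product, sq])
  have h₂' : (#S₂ : ℝ) ≤ #A ^ 2 * (2 * q) := by rw [hq]; exact_mod_cast h₂
  have h₃' : (#S₃ : ℝ) ≤ #A ^ 2 := by exact_mod_cast h₃
  have hle' : (paraboloidEnergy A : ℝ) ≤ #S₁ + (#S₂ + #S₃) := by
    exact_mod_cast hle.trans ((card_union_le _ _).trans (by gcongr; exact card_union_le _ _))
  nlinarith [sq_nonneg (#A : ℝ)]

end Geometry

section Analysis

open ComplexConjugate

variable {F : Type} [Field F] [Fintype F]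

lemma AddChar.conj_apply_eq_map_neg (e : AddChar F ℂ) (t : F) : conj (e t) = e (-t) :=
  (AddChar.map_neg_eq_conj e t).symm

lemma AddChar.sum_dotProduct [DecidableEq F] {e : AddChar F ℂ} (he : e ≠ 1) (u : Fin 3 → F) :
    ∑ x : Fin 3 → F, e (x ⬝ᵥ u) = if u = 0 then (Fintype.card F : ℂ) ^ 3 else 0 := by
  have h1 (x : Fin 3 → F) : e (x ⬝ᵥ u) = ∏ i, e (x i * u i) := by
    simp only [dotProduct, Fin.sum_univ_three, Fin.prod_univ_three, AddChar.map_add_eq_mul]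
  have h2 := Finset.prod_univ_sum (fun _ : Fin 3 => (univ : Finset F)) (fun i x => e (x * u i))
  rw [Fintype.piFinset_univ] at h2
  simp_rw [h1]
  rw [← h2]
  simp_rw [AddChar.sum_mulShift _ (AddChar.IsPrimitive.of_ne_one he)]
  split_ifs with hu
  · simp [hu]
  · obtain ⟨i, hi⟩ := Function.ne_iff.1 hu
    exact prod_eq_zero (mem_univ i) (by simpa using hi)

lemma AddChar.sum_dotProduct_add_mul [DecidableEq F] {e : AddChar F ℂ} (he : e ≠ 1)
    (u : Fin 3 → F) (t : F) :
    ∑ z : (Fin 3 → F) × F, e (z.1 ⬝ᵥ u + z.2 * t)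
      = if u = 0 ∧ t = 0 then (Fintype.card F : ℂ) ^ 4 else 0 := by
  simp_rw [AddChar.map_add_eq_mul, Fintype.sum_prod_type, ← mul_sum, ← sum_mul,
    AddChar.sum_dotProduct he, AddChar.sum_mulShift _ (AddChar.IsPrimitive.of_ne_one he)]
  by_cases hu : u = 0 <;> by_cases ht : t = 0 <;> simp [hu, ht]
  ring

/-- Orthogonality of characters on `F³ × F` for exponential sums with arbitrary frequencies. -/
lemma sum_norm_sq_expSum [DecidableEq F] {e : AddChar F ℂ} (he : e ≠ 1) {ι : Type} [Fintype ι]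
    (w : ι → ℂ) (φ : ι → Fin 3 → F) (χ : ι → F) :
    ((∑ z : (Fin 3 → F) × F, ‖∑ i, w i * e (z.1 ⬝ᵥ φ i + z.2 * χ i)‖ ^ 2 : ℝ) : ℂ)
      = (Fintype.card F : ℂ) ^ 4 *
        ∑ i, ∑ j, if φ i = φ j ∧ χ i = χ j then w i * conj (w j) else 0 := by
  push_cast
  simp_rw [← Complex.mul_conj', map_sum, map_mul, AddChar.conj_apply_eq_map_neg, sum_mul_sum]
  rw [sum_comm, mul_sum]
  refine sum_congr rfl fun i _ => ?_
  rw [sum_comm, mul_sum]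
  refine sum_congr rfl fun j _ => ?_
  have h (z : (Fin 3 → F) × F) :
      w i * e (z.1 ⬝ᵥ φ i + z.2 * χ i) * (conj (w j) * e (-(z.1 ⬝ᵥ φ j + z.2 * χ j)))
        = w i * conj (w j) * e (z.1 ⬝ᵥ (φ i - φ j) + z.2 * (χ i - χ j)) := by
    rw [mul_mul_mul_comm, ← AddChar.map_add_eq_mul, dotProduct_sub]
    congr 2
    ring
  simp_rw [h, ← mul_sum, AddChar.sum_dotProduct_add_mul he, sub_eq_zero]
  split_ifs <;> ring

lemma sum_norm_sq_paraboloidSum {e : AddChar F ℂ} (he : e ≠ 1) (f : (Fin 3 → F) → ℂ) :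
    ∑ z : (Fin 3 → F) × F, ‖∑ y, f y * e (z.1 ⬝ᵥ y + z.2 * (y ⬝ᵥ y))‖ ^ 2
      = (Fintype.card F : ℝ) ^ 4 * ∑ y, ‖f y‖ ^ 2 := by
  classical
  have h := sum_norm_sq_expSum he f (fun y => y) (fun y => y ⬝ᵥ y)
  have h2 (i j : Fin 3 → F) :
      (if i = j ∧ i ⬝ᵥ i = j ⬝ᵥ j then f i * conj (f j) else 0)
        = if i = j then f i * conj (f i) else 0 := by
    by_cases hij : i = j
    · subst hij; simp
    · simp [hij]
  simp_rw [h2, sum_ite_eq, mem_univ, if_true, Complex.mul_conj'] at h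
  exact_mod_cast h

lemma sum_norm_pow_four_paraboloidSum_le [DecidableEq F] {e : AddChar F ℂ} (he : e ≠ 1)
    {A : Finset (Fin 3 → F)} {g : (Fin 3 → F) → ℂ} (hg : ∀ y, ‖g y‖ ≤ if y ∈ A then 1 else 0) :
    ∑ z : (Fin 3 → F) × F, ‖∑ y, g y * e (z.1 ⬝ᵥ y + z.2 * (y ⬝ᵥ y))‖ ^ 4
      ≤ (Fintype.card F : ℝ) ^ 4 * paraboloidEnergy A := by
  have h := sum_norm_sq_expSum he (fun p : (Fin 3 → F) × (Fin 3 → F) => g p.1 * g p.2)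
    (fun p => p.1 + p.2) (fun p => p.1 ⬝ᵥ p.1 + p.2 ⬝ᵥ p.2)
  have hsq (z : (Fin 3 → F) × F) :
      ‖∑ p : (Fin 3 → F) × (Fin 3 → F), g p.1 * g p.2 *
        e (z.1 ⬝ᵥ (p.1 + p.2) + z.2 * (p.1 ⬝ᵥ p.1 + p.2 ⬝ᵥ p.2))‖ ^ 2
        = ‖∑ y, g y * e (z.1 ⬝ᵥ y + z.2 * (y ⬝ᵥ y))‖ ^ 4 := by
    have hT : (∑ y, g y * e (z.1 ⬝ᵥ y + z.2 * (y ⬝ᵥ y))) ^ 2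
        = ∑ p : (Fin 3 → F) × (Fin 3 → F), g p.1 * g p.2 *
          e (z.1 ⬝ᵥ (p.1 + p.2) + z.2 * (p.1 ⬝ᵥ p.1 + p.2 ⬝ᵥ p.2)) := by
      rw [sq, sum_mul_sum, Fintype.sum_prod_type]
      refine sum_congr rfl fun a _ => sum_congr rfl fun b _ => ?_
      rw [mul_mul_mul_comm, ← AddChar.map_add_eq_mul, dotProduct_add]
      congr 2
      ring
    rw [← hT, norm_pow, ← pow_mul]
  simp_rw [hsq] at h
  have hnn : (0 : ℝ) ≤ ∑ z : (Fin 3 → F) × F, ‖∑ y, g y * e (z.1 ⬝ᵥ y + z.2 * (y ⬝ᵥ y))‖ ^ 4 := by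
    positivity
  rw [← abs_of_nonneg hnn, ← Real.norm_eq_abs, ← Complex.norm_real, h, norm_mul, norm_pow,
    Complex.norm_natCast]
  gcongr
  calc _ ≤ ∑ p : (Fin 3 → F) × (Fin 3 → F), ∑ r : (Fin 3 → F) × (Fin 3 → F),
        if ((p.1 ∈ A ∧ p.2 ∈ A) ∧ r.1 ∈ A ∧ r.2 ∈ A) ∧ p.1 + p.2 = r.1 + r.2 ∧
          p.1 ⬝ᵥ p.1 + p.2 ⬝ᵥ p.2 = r.1 ⬝ᵥ r.1 + r.2 ⬝ᵥ r.2 then (1 : ℝ) else 0 := by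
        refine (norm_sum_le _ _).trans (sum_le_sum fun p _ =>
          (norm_sum_le _ _).trans (sum_le_sum fun r _ => ?_))
        have h1 (a : Fin 3 → F) (ha : a ∈ A) : ‖g a‖ ≤ 1 := by simpa [ha] using hg a
        have h0 (a : Fin 3 → F) (ha : a ∉ A) : g a = 0 := by simpa [ha] using hg a
        by_cases hA : (p.1 ∈ A ∧ p.2 ∈ A) ∧ r.1 ∈ A ∧ r.2 ∈ A
        · simp only [hA, and_self, true_and]
          split_ifs
          · simp only [norm_mul, map_mul, RCLike.norm_conj]
            exact mul_le_one₀ (mul_le_one₀ (h1 _ hA.1.1) (norm_nonneg _) (h1 _ hA.1.2))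
              (by positivity) (mul_le_one₀ (h1 _ hA.2.1) (norm_nonneg _) (h1 _ hA.2.2))
          · simp
        · have : g p.1 = 0 ∨ g p.2 = 0 ∨ g r.1 = 0 ∨ g r.2 = 0 := by
            by_contra! hne
            exact hA ⟨⟨not_not.1 fun h => hne.1 (h0 _ h), not_not.1 fun h => hne.2.1 (h0 _ h)⟩,
              not_not.1 fun h => hne.2.2.1 (h0 _ h), not_not.1 fun h => hne.2.2.2 (h0 _ h)⟩
          have hz : g p.1 * g p.2 * conj (g r.1 * g r.2) = 0 := by
            rcases this with h | h | h | h <;> simp [h]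
          rw [hz, ite_self, norm_zero]
          split_ifs <;> norm_num
    _ = paraboloidEnergy A := by
        rw [paraboloidEnergy, ← Fintype.sum_prod_type', ← natCast_card_filter]
        congr 2
        ext ⟨p, r⟩
        simp only [mem_filter, mem_univ, true_and, mem_product]

/-- The Fourier transform (without normalization) of the surface measure of the paraboloid. -/
noncomputable def paraboloidKernel (e : AddChar F ℂ) (x : Fin 3 → F) (t : F) : ℂ :=
  ∑ y : Fin 3 → F, e (x ⬝ᵥ y + t * (y ⬝ᵥ y))

lemma paraboloidKernel_zero_right [DecidableEq F] {e : AddChar F ℂ} (he : e ≠ 1)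
    (x : Fin 3 → F) :
    paraboloidKernel e x 0 = if x = 0 then (Fintype.card F : ℂ) ^ 3 else 0 := by
  rw [← AddChar.sum_dotProduct he x]
  simp [paraboloidKernel, dotProduct_comm]

lemma paraboloidKernel_eq (h2 : (2 : F) ≠ 0) (e : AddChar F ℂ) (x : Fin 3 → F) {t : F}
    (ht : t ≠ 0) :
    paraboloidKernel e x t = e (-(x ⬝ᵥ x) / (4 * t)) * paraboloidKernel e 0 t := by
  have h4 : (4 : F) ≠ 0 := by rw [show (4 : F) = 2 * 2 by norm_num]; exact mul_ne_zero h2 h2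
  rw [paraboloidKernel, paraboloidKernel, mul_sum,
    ← (Equiv.subRight ((2 * t)⁻¹ • x)).sum_comp]
  refine sum_congr rfl fun y _ => ?_
  rw [← AddChar.map_add_eq_mul]
  congr 1
  simp only [Equiv.subRight_apply, dotProduct_sub, sub_dotProduct, smul_dotProduct,
    dotProduct_smul, smul_eq_mul, zero_dotProduct, zero_add, dotProduct_comm y x]
  field_simp
  ring

lemma norm_sq_paraboloidKernel (h2 : (2 : F) ≠ 0) {e : AddChar F ℂ} (he : e ≠ 1)
    (x : Fin 3 → F) {t : F} (ht : t ≠ 0) :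
    ‖paraboloidKernel e x t‖ ^ 2 = (Fintype.card F : ℝ) ^ 3 := by
  classical
  rw [paraboloidKernel_eq h2 e x ht, norm_mul, AddChar.norm_apply, one_mul]
  have h : ((‖paraboloidKernel e 0 t‖ ^ 2 : ℝ) : ℂ) = (Fintype.card F : ℂ) ^ 3 := by
    push_cast
    rw [← Complex.mul_conj', paraboloidKernel, map_sum, sum_mul_sum, sum_comm]
    calc _ = ∑ y : Fin 3 → F, ∑ u : Fin 3 → F, e (t * (u ⬝ᵥ u)) * e (y ⬝ᵥ ((2 * t) • u)) := by
          refine sum_congr rfl fun y _ => ?_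
          rw [← Equiv.sum_comp (Equiv.addRight y)]
          refine sum_congr rfl fun u _ => ?_
          rw [AddChar.conj_apply_eq_map_neg, ← AddChar.map_add_eq_mul, ← AddChar.map_add_eq_mul]
          congr 1
          simp only [Equiv.coe_addRight, dotProduct_add, add_dotProduct, dotProduct_smul,
            smul_eq_mul, zero_dotProduct, zero_add, dotProduct_comm u y]
          ring
      _ = (Fintype.card F : ℂ) ^ 3 := by
          rw [sum_comm]
          simp_rw [← mul_sum, AddChar.sum_dotProduct he, smul_eq_zero, mul_eq_zero, h2, ht,
            false_or, mul_ite, mul_zero, sum_ite_eq', mem_univ, if_true]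
          simp
  exact_mod_cast h

end Analysis

section DualEstimate

open ComplexConjugate

/-- Cauchy–Schwarz summation of the bounds `n³ s⁹ c³ + 2 n³ s¹¹ c²` when `∑ c⁴ = n⁴`. -/
lemma sum_pow_three_add_sum_sq_le {F : Type} [Fintype F] {s n : ℝ} (hs0 : 0 ≤ s) (hn0 : 0 ≤ n)
    (hs : s ^ 4 = Fintype.card F) {c : F → ℝ} (hc0 : ∀ a, 0 ≤ c a) (hc : ∑ a, c a ^ 4 = n ^ 4) :
    ∑ a, (n ^ 3 * s ^ 9 * c a ^ 3 + 2 * n ^ 3 * s ^ 11 * c a ^ 2)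
      ≤ s ^ 10 * n ^ 6 + 2 * s ^ 13 * n ^ 5 := by
  have hsq : ∑ a, c a ^ 2 ≤ s ^ 2 * n ^ 2 := by
    refine (pow_le_pow_iff_left₀ (sum_nonneg fun a _ => by positivity) (by positivity)
      two_ne_zero).1 ?_
    have := sum_mul_sq_le_sq_mul_sq univ (fun _ : F => (1 : ℝ)) (fun a => c a ^ 2)
    simp only [one_mul, one_pow, sum_const, card_univ, nsmul_eq_mul, mul_one, ← hs,
      ← pow_mul, Nat.reduceMul, hc] at this
    linarith
  have hcube : ∑ a, c a ^ 3 ≤ s * n ^ 3 := by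
    refine (pow_le_pow_iff_left₀ (sum_nonneg fun a _ => pow_nonneg (hc0 a) 3) (by positivity)
      two_ne_zero).1 ?_
    have := sum_mul_sq_le_sq_mul_sq univ (fun a => c a) (fun a => c a ^ 2)
    simp only [← pow_succ', ← pow_mul, Nat.reduceMul, Nat.reduceAdd, hc] at this
    calc _ ≤ _ := this
      _ ≤ s ^ 2 * n ^ 2 * n ^ 4 := by gcongr
      _ = _ := by ring
  rw [sum_add_distrib, ← mul_sum, ← mul_sum]
  calc _ ≤ n ^ 3 * s ^ 9 * (s * n ^ 3) + 2 * n ^ 3 * s ^ 11 * (s ^ 2 * n ^ 2) := by gcongr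
    _ = _ := by ring

variable {F : Type} [Field F] [Fintype F]

lemma norm_sum_mul_paraboloidKernel_sub (h2 : (2 : F) ≠ 0) {e : AddChar F ℂ} (he : e ≠ 1)
    (g : (Fin 3 → F) → ℂ) (x : Fin 3 → F) {t : F} (ht : t ≠ 0) :
    ‖∑ y, g y * paraboloidKernel e (x - y) t‖ ^ 4 = (Fintype.card F : ℝ) ^ 6 *
      ‖∑ y, g y * e (((2 * t)⁻¹ • x) ⬝ᵥ y + -(4 * t)⁻¹ * (y ⬝ᵥ y))‖ ^ 4 := by
  have h4 : (4 : F) ≠ 0 := by rw [show (4 : F) = 2 * 2 by norm_num]; exact mul_ne_zero h2 h2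
  have hfac : ∑ y, g y * paraboloidKernel e (x - y) t
      = paraboloidKernel e x t *
        ∑ y, g y * e (((2 * t)⁻¹ • x) ⬝ᵥ y + -(4 * t)⁻¹ * (y ⬝ᵥ y)) := by
    rw [mul_sum]
    refine sum_congr rfl fun y _ => ?_
    rw [paraboloidKernel_eq h2 e (x - y) ht, paraboloidKernel_eq h2 e x ht]
    have harg : e (-((x - y) ⬝ᵥ (x - y)) / (4 * t)) = e (-(x ⬝ᵥ x) / (4 * t)) *
        e (((2 * t)⁻¹ • x) ⬝ᵥ y + -(4 * t)⁻¹ * (y ⬝ᵥ y)) := by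
      rw [← AddChar.map_add_eq_mul]
      congr 1
      simp only [dotProduct_sub, sub_dotProduct, smul_dotProduct, smul_eq_mul,
        dotProduct_comm y x]
      field_simp
      ring
    rw [harg]
    generalize e (((2 * t)⁻¹ • x) ⬝ᵥ y + -(4 * t)⁻¹ * (y ⬝ᵥ y)) = w
    ring
  rw [hfac, norm_mul, mul_pow, show 4 = 2 * 2 from rfl, pow_mul, pow_mul,
    norm_sq_paraboloidKernel h2 he x ht]
  ring

variable [DecidableEq F]

/-- The contribution to `‖ĥ‖²` on the paraboloid of the pairs with distinct last coordinates. -/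
noncomputable def offDiagonal (e : AddChar F ℂ) (h : (Fin 3 → F) × F → ℂ) : ℂ :=
  ∑ p, ∑ r, if p.2 = r.2 then 0 else
    h p * (conj (h r) * paraboloidKernel e (p.1 - r.1) (p.2 - r.2))

lemma sum_norm_sq_dual {e : AddChar F ℂ} (he : e ≠ 1) (h : (Fin 3 → F) × F → ℂ) :
    ((∑ y : Fin 3 → F, ‖∑ p, h p * e (p.1 ⬝ᵥ y + p.2 * (y ⬝ᵥ y))‖ ^ 2 : ℝ) : ℂ)
      = (Fintype.card F : ℂ) ^ 3 * ((∑ p, ‖h p‖ ^ 2 : ℝ) : ℂ) + offDiagonal e h := by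
  push_cast
  simp_rw [← Complex.mul_conj', map_sum, map_mul, AddChar.conj_apply_eq_map_neg, sum_mul_sum]
  rw [sum_comm, offDiagonal, mul_sum, ← sum_add_distrib]
  refine sum_congr rfl fun p _ => ?_
  rw [sum_comm]
  have hdiag : (Fintype.card F : ℂ) ^ 3 * (h p * conj (h p))
      = ∑ r : (Fin 3 → F) × F,
        if r = p then (Fintype.card F : ℂ) ^ 3 * (h p * conj (h r)) else 0 := by
    simp
  rw [hdiag, ← sum_add_distrib]
  refine sum_congr rfl fun r _ => ?_
  have hker : ∑ y : Fin 3 → F, h p * e (p.1 ⬝ᵥ y + p.2 * (y ⬝ᵥ y)) *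
      (conj (h r) * e (-(r.1 ⬝ᵥ y + r.2 * (y ⬝ᵥ y))))
      = h p * (conj (h r) * paraboloidKernel e (p.1 - r.1) (p.2 - r.2)) := by
    rw [paraboloidKernel, mul_sum, mul_sum]
    refine sum_congr rfl fun y _ => ?_
    rw [mul_mul_mul_comm, ← AddChar.map_add_eq_mul, mul_assoc, sub_dotProduct]
    congr 3
    ring
  rw [hker]
  by_cases h2 : p.2 = r.2
  · by_cases h1 : r.1 = p.1
    · have : r = p := Prod.ext h1 h2.symm
      subst this
      simp [paraboloidKernel_zero_right he]
      ring
    · have : r ≠ p := fun h => h1 (h ▸ rfl)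
      simp [h2, paraboloidKernel_zero_right he, sub_eq_zero, this, Ne.symm h1]
  · have : r ≠ p := fun h => h2 (h ▸ rfl)
    simp [h2, this]

lemma norm_offDiagonal_le_sq (h2 : (2 : F) ≠ 0) {e : AddChar F ℂ} (he : e ≠ 1)
    {s : ℝ} (hs : s ^ 4 = Fintype.card F) (h : (Fin 3 → F) × F → ℂ) :
    ‖offDiagonal e h‖ ≤ s ^ 6 * (∑ p, ‖h p‖) ^ 2 := by
  rw [sq, sum_mul_sum, mul_sum]
  refine (norm_sum_le _ _).trans (sum_le_sum fun p _ => ?_)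
  rw [mul_sum]
  refine (norm_sum_le _ _).trans (sum_le_sum fun r _ => ?_)
  split_ifs with hpr
  · rw [norm_zero]; positivity
  · have hD := norm_sq_paraboloidKernel h2 he (p.1 - r.1) (sub_ne_zero.2 hpr)
    have : ‖paraboloidKernel e (p.1 - r.1) (p.2 - r.2)‖ = s ^ 6 := by
      refine (pow_left_inj₀ (norm_nonneg _) (by positivity) two_ne_zero).1 ?_
      rw [hD, ← hs]; ring
    rw [norm_mul, norm_mul, RCLike.norm_conj, this]
    exact le_of_eq (by ring)

lemma sum_norm_pow_four_convolution_le (h2 : (2 : F) ≠ 0) {e : AddChar F ℂ} (he : e ≠ 1)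
    {A : Finset (Fin 3 → F)} {g : (Fin 3 → F) → ℂ} (hg : ∀ y, ‖g y‖ ≤ if y ∈ A then 1 else 0)
    (a : F) :
    ∑ p : (Fin 3 → F) × F,
        (if p.2 = a then 0 else ‖∑ y, g y * paraboloidKernel e (p.1 - y) (p.2 - a)‖) ^ 4
      ≤ (Fintype.card F : ℝ) ^ 10 * paraboloidEnergy A := by
  have h4 : (4 : F) ≠ 0 := by rw [show (4 : F) = 2 * 2 by norm_num]; exact mul_ne_zero h2 h2
  set φ : (Fin 3 → F) × F → (Fin 3 → F) × F :=
    fun p => ((2 * (p.2 - a))⁻¹ • p.1, -(4 * (p.2 - a))⁻¹) with hφ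
  set G : (Fin 3 → F) × F → ℝ := fun z => ‖∑ y, g y * e (z.1 ⬝ᵥ y + z.2 * (y ⬝ᵥ y))‖ ^ 4 with hG
  have hinj : Set.InjOn φ (univ.filter fun p : (Fin 3 → F) × F => p.2 ≠ a) := by
    rintro ⟨x, t⟩ ht ⟨x', t'⟩ ht' heq
    simp only [coe_filter, mem_univ, true_and, Set.mem_ofPred_eq] at ht ht'
    simp only [hφ, Prod.mk.injEq, neg_inj, inv_inj] at heq
    have htt : t = t' := by simpa using mul_left_cancel₀ h4 heq.2
    subst htt
    have hc : (2 * (t - a))⁻¹ ≠ 0 := inv_ne_zero (mul_ne_zero h2 (sub_ne_zero.2 ht))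
    rw [smul_right_injective _ hc heq.1]
  calc _ = ∑ p ∈ univ.filter (fun p : (Fin 3 → F) × F => p.2 ≠ a),
        (Fintype.card F : ℝ) ^ 6 * G (φ p) := by
        rw [sum_filter]
        refine sum_congr rfl fun p _ => ?_
        by_cases hp : p.2 = a
        · simp [hp]
        · simp only [hp, if_false, ne_eq, not_false_eq_true, if_true]
          exact norm_sum_mul_paraboloidKernel_sub h2 he g p.1 (sub_ne_zero.2 hp)
    _ = (Fintype.card F : ℝ) ^ 6 *
        ∑ z ∈ (univ.filter (fun p : (Fin 3 → F) × F => p.2 ≠ a)).image φ, G z := by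
        rw [sum_image hinj, mul_sum]
    _ ≤ (Fintype.card F : ℝ) ^ 6 * ∑ z, G z := by
        gcongr
        exact subset_univ _
    _ ≤ (Fintype.card F : ℝ) ^ 6 * ((Fintype.card F : ℝ) ^ 4 * paraboloidEnergy A) := by
        gcongr
        exact sum_norm_pow_four_paraboloidSum_le he hg
    _ = _ := by ring

lemma norm_offDiagonal_le_of_norm_le_indicator (h2 : (2 : F) ≠ 0) {e : AddChar F ℂ} (he : e ≠ 1)
    {s n : ℝ} (hs0 : 0 < s) (hs : s ^ 4 = Fintype.card F) {E : Finset ((Fin 3 → F) × F)}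
    (hn0 : 0 ≤ n) (hn : n ^ 4 = #E) {h : (Fin 3 → F) × F → ℂ}
    (hh : ∀ p, ‖h p‖ ≤ if p ∈ E then 1 else 0) :
    ‖offDiagonal e h‖ ≤ s ^ 10 * n ^ 6 + 2 * s ^ 13 * n ^ 5 := by
  set A : F → Finset (Fin 3 → F) := fun a => univ.filter fun y => (y, a) ∈ E with hA
  set K : F → (Fin 3 → F) × F → ℝ := fun a p => if p.2 = a then 0 else
    ‖∑ y, conj (h (y, a)) * paraboloidKernel e (p.1 - y) (p.2 - a)‖ with hK
  have hK0 (a : F) (p : (Fin 3 → F) × F) : 0 ≤ K a p := by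
    simp only [hK]; split_ifs <;> positivity
  have hoff : ‖offDiagonal e h‖ ≤ ∑ a, ∑ p ∈ E, K a p := by
    have h1 : offDiagonal e h = ∑ a, ∑ p : (Fin 3 → F) × F, h p * if p.2 = a then 0 else
        ∑ y, conj (h (y, a)) * paraboloidKernel e (p.1 - y) (p.2 - a) := by
      rw [offDiagonal, sum_comm (s := (univ : Finset F))]
      refine sum_congr rfl fun p _ => ?_
      rw [Fintype.sum_prod_type_right]
      refine sum_congr rfl fun a _ => ?_
      by_cases hp : p.2 = a
      · simp [hp]
      · simp only [hp, if_false, mul_sum]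
    rw [h1]
    refine (norm_sum_le _ _).trans (sum_le_sum fun a _ => (norm_sum_le _ _).trans ?_)
    rw [← sum_subset (subset_univ E) fun p _ hp => by
      have hz : h p = 0 := by simpa [hp] using hh p
      simp [hz]]
    refine sum_le_sum fun p hp => ?_
    rw [norm_mul]
    have h1 : ‖h p‖ ≤ 1 := by simpa [hp] using hh p
    calc _ ≤ 1 * ‖_‖ := mul_le_mul_of_nonneg_right h1 (norm_nonneg _)
      _ = K a p := by
        rw [one_mul, apply_ite norm, norm_zero]
  choose c hc0 hc using fun a : F =>
    (⟨(#(A a) : ℝ) ^ ((4 : ℝ)⁻¹), by positivity, by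
      rw [← Real.rpow_natCast, ← Real.rpow_mul (by positivity)]; norm_num⟩ :
      ∃ c : ℝ, 0 ≤ c ∧ c ^ 4 = #(A a))
  have hcsum : ∑ a, c a ^ 4 = n ^ 4 := by
    simp_rw [hc, hn]
    rw [← Nat.cast_sum, Nat.cast_inj, card_eq_sum_card_fiberwise (f := Prod.snd) (t := univ)
      (by simp)]
    refine sum_congr rfl fun a _ => ?_
    refine card_nbij' (fun y => (y, a)) Prod.fst ?_ ?_ ?_ ?_
    · intro y hy; simpa [hA] using hy
    · rintro ⟨y, b⟩ hp
      obtain ⟨hp, rfl⟩ : (y, b) ∈ E ∧ b = a := by simpa using hp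
      simpa [hA] using hp
    · intro y _; rfl
    · rintro ⟨y, b⟩ hp
      obtain ⟨hp, rfl⟩ : (y, b) ∈ E ∧ b = a := by simpa using hp
      rfl
  refine hoff.trans ((sum_le_sum fun a _ => ?_).trans
    (sum_pow_three_add_sum_sq_le hs0.le hn0 hs hc0 hcsum))
  have hc0 := hc0 a
  refine (pow_le_pow_iff_left₀ (sum_nonneg fun p _ => hK0 a p) (by positivity)
    four_ne_zero).1 ?_
  have hpow : (∑ p ∈ E, K a p) ^ 4 ≤ (#E : ℝ) ^ 3 * ∑ p ∈ E, K a p ^ 4 :=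
    pow_sum_le_card_mul_sum_pow (fun p _ => hK0 a p) 3
  have hfour : ∑ p ∈ E, K a p ^ 4 ≤ (Fintype.card F : ℝ) ^ 10 * paraboloidEnergy (A a) := by
    refine (sum_le_univ_sum_of_nonneg fun p => pow_nonneg (hK0 a p) 4).trans ?_
    refine sum_norm_pow_four_convolution_le h2 he (fun y => ?_) a
    simpa [hA] using hh (y, a)
  calc _ ≤ _ := hpow
    _ ≤ (#E : ℝ) ^ 3 * ((Fintype.card F : ℝ) ^ 10 *
        (#(A a) ^ 3 / Fintype.card F + 7 * Fintype.card F * #(A a) ^ 2)) := by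
        gcongr
        exact hfour.trans (by gcongr; exact paraboloidEnergy_le h2 _)
    _ = n ^ 12 * s ^ 36 * c a ^ 12 + 7 * (n ^ 12 * s ^ 44 * c a ^ 8) := by
        rw [← hn, ← hs, ← hc]
        field_simp
    _ ≤ (n ^ 3 * s ^ 9 * c a ^ 3) ^ 4 + (2 * n ^ 3 * s ^ 11 * c a ^ 2) ^ 4 := by
        have : 0 ≤ n ^ 12 * s ^ 44 * c a ^ 8 := by positivity
        nlinarith
    _ ≤ _ := pow_add_pow_le (by positivity) (by positivity) four_ne_zero

end DualEstimate

section Restriction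

open ComplexConjugate

variable {F : Type} [Field F] [Fintype F]

lemma extOp_four_eq (e : AddChar F ℂ) (f : (Fin 3 → F) → ℂ) (x : (Fin 3 → F) × F) :
    extOp (d := 4) e f x = ((Fintype.card F : ℂ) ^ 3)⁻¹ *
      ∑ y : Fin 3 → F, f y * e (x.1 ⬝ᵥ y + x.2 * (y ⬝ᵥ y)) := rfl

lemma extOp_four_const_mul (e : AddChar F ℂ) (c : ℂ) (f : (Fin 3 → F) → ℂ)
    (x : (Fin 3 → F) × F) :
    extOp (d := 4) e (fun y => c * f y) x = c * extOp (d := 4) e f x := by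
  rw [extOp_four_eq, extOp_four_eq, mul_left_comm, mul_sum (a := c)]
  simp_rw [mul_assoc]

lemma sum_norm_sq_extOp {e : AddChar F ℂ} (he : e ≠ 1) (f : (Fin 3 → F) → ℂ) :
    ∑ x : (Fin 3 → F) × F, ‖extOp (d := 4) e f x‖ ^ 2
      = Fintype.card F * (((Fintype.card F : ℝ) ^ 3)⁻¹ * ∑ y, ‖f y‖ ^ 2) := by
  have hq : (Fintype.card F : ℝ) ≠ 0 := by exact_mod_cast Fintype.card_ne_zero
  simp_rw [extOp_four_eq, norm_mul, mul_pow, ← mul_sum, sum_norm_sq_paraboloidSum he,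
    norm_inv, norm_pow, Complex.norm_natCast]
  field_simp

lemma norm_extOp_le_one (e : AddChar F ℂ) {f : (Fin 3 → F) → ℂ}
    (hf : ((Fintype.card F : ℝ) ^ 3)⁻¹ * ∑ y, ‖f y‖ ^ 2 ≤ 1) (x : (Fin 3 → F) × F) :
    ‖extOp (d := 4) e f x‖ ≤ 1 := by
  have hq : (0 : ℝ) < (Fintype.card F : ℝ) ^ 3 := by
    have : 0 < Fintype.card F := Fintype.card_pos
    positivity
  rw [inv_mul_le_iff₀ hq, mul_one] at hf
  rw [extOp_four_eq, norm_mul, norm_inv, norm_pow, Complex.norm_natCast, inv_mul_le_iff₀ hq,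
    mul_one]
  have h1 : ‖∑ y : Fin 3 → F, f y * e (x.1 ⬝ᵥ y + x.2 * (y ⬝ᵥ y))‖ ≤ ∑ y, ‖f y‖ :=
    (norm_sum_le _ _).trans (le_of_eq (by simp [AddChar.norm_apply]))
  have h2 := sum_mul_sq_le_sq_mul_sq univ (fun _ : Fin 3 → F => (1 : ℝ)) (fun y => ‖f y‖)
  simp only [one_mul, one_pow, sum_const, card_univ, Fintype.card_pi, prod_const, Fintype.card_fin,
    nsmul_eq_mul, mul_one, Nat.cast_pow] at h2
  refine h1.trans ((pow_le_pow_iff_left₀ (by positivity) hq.le two_ne_zero).1 (h2.trans ?_))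
  rw [sq]
  gcongr

/-- Duality between extension and restriction. -/
lemma norm_sum_mul_extOp_sq_le [DecidableEq F] {e : AddChar F ℂ} (he : e ≠ 1)
    {f : (Fin 3 → F) → ℂ} (hf : ((Fintype.card F : ℝ) ^ 3)⁻¹ * ∑ y, ‖f y‖ ^ 2 ≤ 1)
    (h : (Fin 3 → F) × F → ℂ) :
    ‖∑ x, h x * extOp (d := 4) e f x‖ ^ 2
      ≤ ∑ x, ‖h x‖ ^ 2 + ((Fintype.card F : ℝ) ^ 3)⁻¹ * ‖offDiagonal e h‖ := by
  have hq : (0 : ℝ) < (Fintype.card F : ℝ) ^ 3 := by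
    have : 0 < Fintype.card F := Fintype.card_pos
    positivity
  set Q : ℝ := ∑ y : Fin 3 → F, ‖∑ p : (Fin 3 → F) × F, h p * e (p.1 ⬝ᵥ y + p.2 * (y ⬝ᵥ y))‖ ^ 2
    with hQ
  have hQle : Q ≤ (Fintype.card F : ℝ) ^ 3 * ∑ x, ‖h x‖ ^ 2 + ‖offDiagonal e h‖ := by
    have hre := congrArg Complex.re (sum_norm_sq_dual he h)
    rw [Complex.ofReal_re, Complex.add_re, ← Complex.ofReal_natCast, ← Complex.ofReal_pow,
      ← Complex.ofReal_mul, Complex.ofReal_re] at hre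
    rw [hQ, hre]
    gcongr
    exact Complex.re_le_norm _
  have hswap : ∑ x, h x * extOp (d := 4) e f x = ((Fintype.card F : ℂ) ^ 3)⁻¹ *
      ∑ y : Fin 3 → F, f y * ∑ p : (Fin 3 → F) × F, h p * e (p.1 ⬝ᵥ y + p.2 * (y ⬝ᵥ y)) := by
    simp_rw [extOp_four_eq, mul_sum]
    rw [sum_comm]
    refine sum_congr rfl fun y _ => sum_congr rfl fun x _ => ?_
    generalize e _ = w
    ring
  rw [hswap, norm_mul, norm_inv, norm_pow, Complex.norm_natCast, mul_pow]
  calc _ ≤ (((Fintype.card F : ℝ) ^ 3)⁻¹) ^ 2 * ((∑ y, ‖f y‖ ^ 2) * Q) := by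
        gcongr
        refine le_trans ?_ (sum_mul_sq_le_sq_mul_sq univ _ _)
        gcongr
        exact (norm_sum_le _ _).trans (le_of_eq (by simp only [norm_mul]))
    _ = (((Fintype.card F : ℝ) ^ 3)⁻¹ * ∑ y, ‖f y‖ ^ 2) *
        (((Fintype.card F : ℝ) ^ 3)⁻¹ * Q) := by ring
    _ ≤ 1 * (((Fintype.card F : ℝ) ^ 3)⁻¹ *
        ((Fintype.card F : ℝ) ^ 3 * ∑ x, ‖h x‖ ^ 2 + ‖offDiagonal e h‖)) := by
        gcongr
    _ = _ := by field_simp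

lemma pow_mul_pow_le_of_sq_mul_le {s n lam : ℝ} (hs : 1 ≤ s) (hn : 0 ≤ n) (hlam1 : lam ≤ 1)
    (hlam : (s ^ 4)⁻¹ ≤ lam) (h : lam ^ 2 * n ^ 8 ≤ n ^ 4 + n ^ 6 / s ^ 2 + 2 * n ^ 5 * s) :
    (n ^ 4) ^ 3 * lam ^ 8 ≤ 4096 * s ^ 4 := by
  have hs0 : 0 < s := by linarith
  have hlam0 : 0 < lam := lt_of_lt_of_le (by positivity) hlam
  have hsp : 1 ≤ s ^ 4 := one_le_pow₀ hs
  rcases hn.eq_or_lt with rfl | hn0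
  · simp; positivity
  have h' : lam ^ 2 * n ^ 4 ≤ 1 + n ^ 2 / s ^ 2 + 2 * (n * s) := by
    refine le_of_mul_le_mul_left ?_ (pow_pos hn0 4)
    calc _ = lam ^ 2 * n ^ 8 := by ring
      _ ≤ _ := h
      _ = _ := by ring
  by_cases h1 : lam ^ 2 * n ^ 4 ≤ 4
  · calc (n ^ 4) ^ 3 * lam ^ 8 = (lam ^ 2 * n ^ 4) ^ 3 * lam ^ 2 := by ring
      _ ≤ 4 ^ 3 * 1 ^ 2 := by gcongr
      _ ≤ 4096 * s ^ 4 := by linarith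
  by_cases h2 : lam ^ 2 * n ^ 4 ≤ 4 * (n ^ 2 / s ^ 2)
  · have h3 : lam ^ 2 * n ^ 2 * s ^ 2 ≤ 4 := by
      rw [← mul_div_assoc, le_div_iff₀ (by positivity)] at h2
      exact le_of_mul_le_mul_left (by linarith) (pow_pos hn0 2)
    have h4 : 1 ≤ lam * s ^ 4 := (inv_le_iff_one_le_mul₀ (by positivity)).1 hlam
    calc (n ^ 4) ^ 3 * lam ^ 8 ≤ (n ^ 4) ^ 3 * lam ^ 8 * (lam * s ^ 4) ^ 4 :=
          le_mul_of_one_le_right (by positivity) (one_le_pow₀ h4)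
      _ = (lam ^ 2 * n ^ 2 * s ^ 2) ^ 6 * s ^ 4 := by ring
      _ ≤ 4 ^ 6 * s ^ 4 := by gcongr
      _ = _ := by norm_num
  · have h3 : lam ^ 2 * n ^ 4 ≤ 4 * (n * s) := by linarith
    have h4 : lam ^ 2 * n ^ 3 ≤ 4 * s := le_of_mul_le_mul_left (by linarith) hn0
    calc (n ^ 4) ^ 3 * lam ^ 8 = (lam ^ 2 * n ^ 3) ^ 4 := by ring
      _ ≤ (4 * s) ^ 4 := by gcongr
      _ ≤ _ := by linarith

lemma card_lt_norm_extOp_le (h2 : (2 : F) ≠ 0) {e : AddChar F ℂ} (he : e ≠ 1)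
    {f : (Fin 3 → F) → ℂ} (hf : ((Fintype.card F : ℝ) ^ 3)⁻¹ * ∑ y, ‖f y‖ ^ 2 ≤ 1)
    {s lam : ℝ} (hs1 : 1 ≤ s) (hs : s ^ 4 = Fintype.card F) (hlam : (s ^ 4)⁻¹ ≤ lam)
    (hlam1 : lam ≤ 1) :
    (#{x : (Fin 3 → F) × F | lam < ‖extOp (d := 4) e f x‖} : ℝ) ^ 3 * lam ^ 8
      ≤ 4096 * s ^ 4 := by
  classical
  set E : Finset ((Fin 3 → F) × F) := {x | lam < ‖extOp (d := 4) e f x‖} with hE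
  have hs0 : 0 < s := by linarith
  have hlam0 : 0 < lam := lt_of_lt_of_le (by positivity) hlam
  obtain ⟨n, hn0, hn⟩ : ∃ n : ℝ, 0 ≤ n ∧ n ^ 4 = #E := ⟨(#E : ℝ) ^ ((4 : ℝ)⁻¹), by positivity, by
    rw [← Real.rpow_natCast, ← Real.rpow_mul (by positivity)]; norm_num⟩
  have hEmem (x) (hx : x ∈ E) : lam < ‖extOp (d := 4) e f x‖ := by simpa [hE] using hx
  set h : (Fin 3 → F) × F → ℂ := fun x => if x ∈ E then
    conj (extOp (d := 4) e f x) / ‖extOp (d := 4) e f x‖ else 0 with hh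
  have hh1 (x) : ‖h x‖ ≤ if x ∈ E then 1 else 0 := by
    by_cases hx : x ∈ E
    · simp [hh, hx, div_self_le_one]
    · simp [hh, hx]
  have hsum : ∑ x, h x * extOp (d := 4) e f x = ((∑ x ∈ E, ‖extOp (d := 4) e f x‖ : ℝ) : ℂ) := by
    rw [← sum_subset (subset_univ E) fun x _ hx => by simp [hh, hx], Complex.ofReal_sum]
    refine sum_congr rfl fun x hx => ?_
    have : ((‖extOp (d := 4) e f x‖ : ℝ) : ℂ) ≠ 0 := by
      exact_mod_cast (hlam0.trans (hEmem x hx)).ne'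
    simp only [hh, hx, if_true]
    rw [div_mul_eq_mul_div, mul_comm, Complex.mul_conj', sq, mul_div_assoc, div_self this, mul_one]
  have hdual := norm_sum_mul_extOp_sq_le he hf h
  have hoff := norm_offDiagonal_le_of_norm_le_indicator h2 he hs0 hs hn0 hn hh1
  have hlow : lam * n ^ 4 ≤ ∑ x ∈ E, ‖extOp (d := 4) e f x‖ := by
    rw [hn, mul_comm, ← nsmul_eq_mul]
    exact card_nsmul_le_sum _ _ _ fun x hx => (hEmem x hx).le
  have hl2 : ∑ x, ‖h x‖ ^ 2 ≤ n ^ 4 := by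
    rw [hn, ← sum_subset (subset_univ E) fun x _ hx => by simp [hh, hx], card_eq_sum_ones,
      Nat.cast_sum]
    refine sum_le_sum fun x hx => ?_
    have : ‖h x‖ ≤ 1 := by simpa [hx] using hh1 x
    simpa using this
  rw [hsum, Complex.norm_real, Real.norm_eq_abs, sq_abs] at hdual
  rw [← hn]
  refine pow_mul_pow_le_of_sq_mul_le hs1 hn0 hlam1 hlam ?_
  calc lam ^ 2 * n ^ 8 = (lam * n ^ 4) ^ 2 := by ring
    _ ≤ (∑ x ∈ E, ‖extOp (d := 4) e f x‖) ^ 2 := by gcongr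
    _ ≤ n ^ 4 + ((Fintype.card F : ℝ) ^ 3)⁻¹ * (s ^ 10 * n ^ 6 + 2 * s ^ 13 * n ^ 5) := by
        refine hdual.trans ?_
        gcongr
    _ = _ := by
        rw [← hs]
        field_simp
        ring

lemma sum_lt_norm_sq_extOp_le (h2 : (2 : F) ≠ 0) {e : AddChar F ℂ} (he : e ≠ 1)
    {f : (Fin 3 → F) → ℂ} (hf : ((Fintype.card F : ℝ) ^ 3)⁻¹ * ∑ y, ‖f y‖ ^ 2 ≤ 1)
    {s α : ℝ} (hs0 : 0 < s) (hs : s ^ 4 = Fintype.card F) (hα : 0 < α)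
    (hαs : 2 ≤ α ^ 2 * s ^ 6) :
    ∑ x : (Fin 3 → F) × F with α < ‖extOp (d := 4) e f x‖, ‖extOp (d := 4) e f x‖ ^ 2 ≤ 2 := by
  classical
  set E : Finset ((Fin 3 → F) × F) := {x | α < ‖extOp (d := 4) e f x‖} with hE
  set X : ℝ := ∑ x ∈ E, ‖extOp (d := 4) e f x‖ ^ 2 with hX
  have hEmem (x) (hx : x ∈ E) : α < ‖extOp (d := 4) e f x‖ := by simpa [hE] using hx
  set h : (Fin 3 → F) × F → ℂ := fun x => if x ∈ E then conj (extOp (d := 4) e f x) else 0 with hh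
  have hsum : ∑ x, h x * extOp (d := 4) e f x = (X : ℂ) := by
    rw [← sum_subset (subset_univ E) fun x _ hx => by simp [hh, hx], hX, Complex.ofReal_sum]
    refine sum_congr rfl fun x hx => ?_
    simp only [hh, hx, if_true]
    rw [mul_comm, Complex.mul_conj', Complex.ofReal_pow]
  have hl2 : ∑ x, ‖h x‖ ^ 2 = X := by
    rw [← sum_subset (subset_univ E) fun x _ hx => by simp [hh, hx], hX]
    exact sum_congr rfl fun x hx => by simp [hh, hx]
  have hl1 : α * ∑ x, ‖h x‖ ≤ X := by
    rw [← sum_subset (subset_univ E) fun x _ hx => by simp [hh, hx], hX, mul_sum]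
    refine sum_le_sum fun x hx => ?_
    simp only [hh, hx, if_true, RCLike.norm_conj, sq]
    gcongr
    exact (hEmem x hx).le
  have hdual := norm_sum_mul_extOp_sq_le he hf h
  have hoff := norm_offDiagonal_le_sq h2 he hs h
  rw [hsum, hl2, Complex.norm_real, Real.norm_eq_abs, sq_abs] at hdual
  have hX0 : 0 ≤ X := sum_nonneg fun x _ => by positivity
  set Y : ℝ := ∑ x, ‖h x‖ with hY
  have hY0 : 0 ≤ Y := sum_nonneg fun x _ => norm_nonneg _
  have h1 : ((Fintype.card F : ℝ) ^ 3)⁻¹ * ‖offDiagonal e h‖ ≤ X ^ 2 / 2 := by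
    rw [← hs, inv_mul_le_iff₀ (by positivity)]
    calc _ ≤ _ := hoff
      _ ≤ s ^ 6 * Y ^ 2 * (α ^ 2 * s ^ 6 / 2) := le_mul_of_one_le_right (by positivity) (by linarith)
      _ = (s ^ 4) ^ 3 * ((α * Y) ^ 2 / 2) := by ring
      _ ≤ _ := by gcongr
  nlinarith

end Restriction

section LevelSets

variable {ι : Type} [Fintype ι] {γ : ι → ℝ} {σ : ℝ}

lemma sum_pow_le_of_card_lt_le (hγ0 : ∀ i, 0 ≤ γ i) (hσ : 1 ≤ σ)
    (hmid : ∀ lam : ℝ, (σ ^ 12)⁻¹ ≤ lam → lam ≤ 1 →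
      (#{i | lam < γ i ^ 9} : ℝ) ^ 3 * lam ^ 8 ≤ 4096 * σ ^ 12)
    (k : ℕ) {τ : ℝ} (hτ0 : 0 ≤ τ) (hτ2 : τ ≤ 2 / σ) (hτk : τ ≤ 2 ^ k * (σ ^ 2)⁻¹) :
    ∑ i with (σ ^ 12)⁻¹ < γ i ^ 9 ∧ γ i ≤ τ, γ i ^ 28 ≤ 2 ^ 29 * σ ^ 4 * τ ^ 4 := by
  have hσ0 : 0 < σ := by linarith
  induction k generalizing τ with
  | zero =>
    rw [filter_false_of_mem, sum_empty]
    · positivity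
    · rintro i - ⟨h1, h2⟩
      refine absurd h1 (not_lt.2 ?_)
      calc γ i ^ 9 ≤ ((σ ^ 2)⁻¹) ^ 9 := by
            have := hγ0 i
            gcongr
            linarith
        _ = (σ ^ 18)⁻¹ := by rw [inv_pow, ← pow_mul]
        _ ≤ (σ ^ 12)⁻¹ := by gcongr; norm_num
  | succ k ih =>
    set lam : ℝ := max ((τ / 2) ^ 9) (σ ^ 12)⁻¹ with hlam
    set N : ℝ := (#{i | lam < γ i ^ 9} : ℝ) with hN
    have hN0 : 0 ≤ N := Nat.cast_nonneg _
    have hτ1 : τ / 2 ≤ 1 := by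
      have : 2 / σ ≤ 2 := div_le_self (by norm_num) hσ
      linarith
    have hNle : N * (τ / 2) ^ 24 ≤ 16 * σ ^ 4 := by
      refine (pow_le_pow_iff_left₀ (by positivity) (by positivity) three_ne_zero).1 ?_
      calc (N * (τ / 2) ^ 24) ^ 3 = N ^ 3 * ((τ / 2) ^ 9) ^ 8 := by ring
        _ ≤ N ^ 3 * lam ^ 8 := by gcongr; exact le_max_left _ _
        _ ≤ 4096 * σ ^ 12 := hmid lam (le_max_right _ _)
            (max_le (pow_le_one₀ (by positivity) hτ1) (inv_le_one_of_one_le₀ (one_le_pow₀ hσ)))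
        _ = _ := by ring
    have hih := ih (τ := τ / 2) (by positivity) (by linarith) (by rw [pow_succ] at hτk; linarith)
    calc ∑ i with (σ ^ 12)⁻¹ < γ i ^ 9 ∧ γ i ≤ τ, γ i ^ 28
        ≤ ∑ i, ((if (σ ^ 12)⁻¹ < γ i ^ 9 ∧ γ i ≤ τ / 2 then γ i ^ 28 else 0) +
          (if lam < γ i ^ 9 then τ ^ 28 else 0)) := by
          rw [sum_filter]
          refine sum_le_sum fun i _ => ?_
          have h0 := hγ0 i
          by_cases hi : (σ ^ 12)⁻¹ < γ i ^ 9 ∧ γ i ≤ τ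
          · rw [if_pos hi]
            rcases le_or_gt (γ i) (τ / 2) with h | h
            · rw [if_pos ⟨hi.1, h⟩]
              refine le_add_of_nonneg_right ?_
              split_ifs <;> positivity
            · rw [if_neg fun h' => h.not_ge h'.2, zero_add,
                if_pos (max_lt (by gcongr) hi.1)]
              gcongr
              exact hi.2
          · rw [if_neg hi]
            refine add_nonneg ?_ ?_ <;> split_ifs <;> positivity
      _ = ∑ i with (σ ^ 12)⁻¹ < γ i ^ 9 ∧ γ i ≤ τ / 2, γ i ^ 28 +
          N * (τ / 2) ^ 24 * (2 ^ 24 * τ ^ 4) := by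
          rw [sum_add_distrib, ← sum_filter, ← sum_filter, sum_const, nsmul_eq_mul, ← hN]
          ring
      _ ≤ 2 ^ 29 * σ ^ 4 * (τ / 2) ^ 4 + 16 * σ ^ 4 * (2 ^ 24 * τ ^ 4) := by gcongr
      _ ≤ 2 ^ 29 * σ ^ 4 * τ ^ 4 := by
          have : 0 ≤ σ ^ 4 * τ ^ 4 := by positivity
          linarith

lemma sum_pow_le_of_level_sets (hγ0 : ∀ i, 0 ≤ γ i) (hγ1 : ∀ i, γ i ≤ 1) (hσ : 1 ≤ σ)
    (hsmall : ∑ i, γ i ^ 18 ≤ σ ^ 12)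
    (hmid : ∀ lam : ℝ, (σ ^ 12)⁻¹ ≤ lam → lam ≤ 1 →
      (#{i | lam < γ i ^ 9} : ℝ) ^ 3 * lam ^ 8 ≤ 4096 * σ ^ 12)
    (hlarge : ∀ α : ℝ, 0 < α → 2 ≤ α ^ 2 * σ ^ 18 → ∑ i with α < γ i ^ 9, γ i ^ 18 ≤ 2) :
    ∑ i, γ i ^ 28 ≤ 2 ^ 34 := by
  have hσ0 : 0 < σ := by linarith
  obtain ⟨k, hk⟩ := pow_unbounded_of_one_lt (2 / σ * σ ^ 2) (one_lt_two (α := ℝ))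
  have hmid' := sum_pow_le_of_card_lt_le hγ0 hσ hmid k (by positivity) le_rfl
    (by rw [← div_eq_mul_inv, le_div_iff₀ (by positivity)]; exact hk.le)
  have hlarge' := hlarge ((2 / σ) ^ 9) (by positivity) (by
    have : ((2 / σ) ^ 9) ^ 2 * σ ^ 18 = 2 ^ 18 := by field_simp
    rw [this]; norm_num)
  have hval : 2 ^ 29 * σ ^ 4 * (2 / σ) ^ 4 = 2 ^ 33 := by field_simp
  rw [hval] at hmid'
  calc ∑ i, γ i ^ 28 ≤ ∑ i, ((σ ^ 12)⁻¹ * γ i ^ 18 +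
        (if (σ ^ 12)⁻¹ < γ i ^ 9 ∧ γ i ≤ 2 / σ then γ i ^ 28 else 0) +
        (if (2 / σ) ^ 9 < γ i ^ 9 then γ i ^ 18 else 0)) := by
        refine sum_le_sum fun i _ => ?_
        have h0 := hγ0 i
        have h1 := hγ1 i
        have hs0 : 0 ≤ (σ ^ 12)⁻¹ * γ i ^ 18 := by positivity
        by_cases hl : (2 / σ) ^ 9 < γ i ^ 9
        · have : γ i ^ 28 ≤ γ i ^ 18 := pow_le_pow_of_le_one h0 h1 (by norm_num)
          rw [if_pos hl]
          split_ifs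
          · linarith [pow_nonneg h0 28]
          · linarith
        · rw [if_neg hl]
          have hle : γ i ≤ 2 / σ :=
            (pow_le_pow_iff_left₀ h0 (by positivity) (by norm_num)).1 (not_lt.1 hl)
          by_cases hm : (σ ^ 12)⁻¹ < γ i ^ 9
          · rw [if_pos ⟨hm, hle⟩]; linarith
          · rw [if_neg fun h => hm h.1]
            have : γ i ^ 28 ≤ (σ ^ 12)⁻¹ * γ i ^ 18 := by
              calc γ i ^ 28 ≤ γ i ^ 27 := pow_le_pow_of_le_one h0 h1 (by norm_num)
                _ = γ i ^ 9 * γ i ^ 18 := by ring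
                _ ≤ _ := by gcongr; exact not_lt.1 hm
            linarith
    _ ≤ 1 + 2 ^ 33 + 2 := by
        rw [sum_add_distrib, sum_add_distrib, ← sum_filter, ← sum_filter, ← mul_sum]
        gcongr
        rw [inv_mul_le_iff₀ (by positivity), mul_one]
        exact hsmall
    _ ≤ _ := by norm_num

end LevelSets

section Main

variable {F : Type} [Field F] [Fintype F]

lemma sum_norm_extOp_rpow_le (h2 : (2 : F) ≠ 0) {e : AddChar F ℂ} (he : e ≠ 1)
    {f : (Fin 3 → F) → ℂ} (hf : ((Fintype.card F : ℝ) ^ 3)⁻¹ * ∑ y, ‖f y‖ ^ 2 ≤ 1) :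
    ∑ x : (Fin 3 → F) × F, ‖extOp (d := 4) e f x‖ ^ ((28 : ℝ) / 9) ≤ 2 ^ 34 := by
  have hq : (1 : ℝ) ≤ Fintype.card F := Nat.one_le_cast.2 Fintype.card_pos
  obtain ⟨σ, hσ1, hσ⟩ : ∃ σ : ℝ, 1 ≤ σ ∧ σ ^ 12 = Fintype.card F :=
    ⟨(Fintype.card F : ℝ) ^ ((12 : ℝ)⁻¹), Real.one_le_rpow hq (by norm_num), by
      rw [← Real.rpow_natCast, ← Real.rpow_mul (by positivity)]; norm_num⟩
  have hs : (σ ^ 3) ^ 4 = Fintype.card F := by rw [← hσ]; ring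
  set γ : (Fin 3 → F) × F → ℝ := fun x => ‖extOp (d := 4) e f x‖ ^ ((9 : ℝ)⁻¹) with hγ
  have hγ9 (x) : γ x ^ 9 = ‖extOp (d := 4) e f x‖ := by
    rw [hγ, ← Real.rpow_natCast, ← Real.rpow_mul (norm_nonneg _)]; norm_num
  have hγ18 (x) : γ x ^ 18 = ‖extOp (d := 4) e f x‖ ^ 2 := by rw [← hγ9, ← pow_mul]
  have hγ28 (x) : ‖extOp (d := 4) e f x‖ ^ ((28 : ℝ) / 9) = γ x ^ 28 := by
    rw [hγ, ← Real.rpow_natCast, ← Real.rpow_mul (norm_nonneg _)]; norm_num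
  simp_rw [hγ28]
  refine sum_pow_le_of_level_sets (σ := σ) (fun x => by positivity)
    (fun x => Real.rpow_le_one (norm_nonneg _) (norm_extOp_le_one e hf x) (by norm_num)) hσ1
    ?_ (fun lam hl hl1 => ?_) (fun α hα hα2 => ?_)
  · simp_rw [hγ18, sum_norm_sq_extOp he, hσ]
    exact mul_le_of_le_one_right (by positivity) hf
  · simp_rw [hγ9]
    have := card_lt_norm_extOp_le h2 he hf (one_le_pow₀ hσ1) hs (by rwa [← pow_mul]) hl1
    rwa [← pow_mul] at this
  · simp_rw [hγ9, hγ18]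
    exact sum_lt_norm_sq_extOp_le h2 he hf (by positivity) hs hα (by rwa [← pow_mul])

end Main

/-- Let `d = 4`. There is `C > 0` such that for every finite field `F` of odd
characteristic, every nontrivial additive character `e` of `F`, and every `f : P → ℂ` on
the paraboloid `P ⊆ F^4`, one has `‖(f dσ)^∨‖_{L^{28/9}(F^4)} ≤ C ‖f‖_{L^2(P,dσ)}`. -/
theorem stmt2 :
    ∃ C : ℝ, 0 < C ∧
      ∀ (F : Type) [Field F] [Fintype F], ringChar F ≠ 2 →
      ∀ (e : AddChar F ℂ), e ≠ 1 →
      ∀ f : (Fin (4 - 1) → F) → ℂ,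
        (∑ x : (Fin (4 - 1) → F) × F,
            ‖extOp (d := 4) e f x‖ ^ ((28 : ℝ) / 9)) ^ ((9 : ℝ) / 28)
          ≤ C * (((Fintype.card F : ℝ) ^ (4 - 1))⁻¹ *
              ∑ y : Fin (4 - 1) → F, ‖f y‖ ^ 2) ^ ((1 : ℝ) / 2) := by
  refine ⟨(2 ^ 34) ^ ((9 : ℝ) / 28), by positivity, ?_⟩
  intro F _ _ hchar e he f
  change (Fin 3 → F) → ℂ at f
  change (∑ x : (Fin 3 → F) × F, _) ^ _ ≤ _ * (((Fintype.card F : ℝ) ^ 3)⁻¹ *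
    ∑ y : Fin 3 → F, ‖f y‖ ^ 2) ^ _
  have hq : (0 : ℝ) < (Fintype.card F : ℝ) ^ 3 := pow_pos (Nat.cast_pos.2 Fintype.card_pos) 3
  set M : ℝ := ((Fintype.card F : ℝ) ^ 3)⁻¹ * ∑ y : Fin 3 → F, ‖f y‖ ^ 2 with hM
  have hM0 : 0 ≤ M := by positivity
  rw [← Real.sqrt_eq_rpow]
  rcases hM0.eq_or_lt with hMz | hMpos
  · have hf0 (y) : f y = 0 := by
      have h := (mul_eq_zero.1 (hM.symm.trans hMz.symm)).resolve_left (inv_ne_zero hq.ne')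
      have := (sum_eq_zero_iff_of_nonneg fun y _ => by positivity).1 h y (mem_univ y)
      simpa using this
    have hz (x : (Fin 3 → F) × F) : extOp (d := 4) e f x = 0 := by
      simp [extOp_four_eq, hf0]
    simp_rw [hz]
    simp [← hMz]
  · have hr : 0 < √M := Real.sqrt_pos.2 hMpos
    set g : (Fin 3 → F) → ℂ := fun y => ((√M)⁻¹ : ℝ) * f y with hg
    have hg1 : ((Fintype.card F : ℝ) ^ 3)⁻¹ * ∑ y, ‖g y‖ ^ 2 ≤ 1 := by
      simp_rw [hg, norm_mul, mul_pow, ← mul_sum, Complex.norm_real, Real.norm_eq_abs, sq_abs,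
        inv_pow, Real.sq_sqrt hM0]
      rw [mul_left_comm, ← hM, inv_mul_cancel₀ hMpos.ne']
    have hfg (x : (Fin 3 → F) × F) :
        ‖extOp (d := 4) e f x‖ = √M * ‖extOp (d := 4) e g x‖ := by
      rw [hg, extOp_four_const_mul, norm_mul, Complex.norm_real, Real.norm_of_nonneg (by positivity),
        mul_inv_cancel_left₀ hr.ne']
    simp_rw [hfg, Real.mul_rpow hr.le (norm_nonneg _), ← mul_sum]
    rw [Real.mul_rpow (by positivity) (sum_nonneg fun x _ => by positivity),
      ← Real.rpow_mul hr.le, mul_comm]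
    norm_num only [Real.rpow_one]
    gcongr
    have := sum_norm_extOp_rpow_le (Ring.two_ne_zero hchar) he hg1
    norm_num at this ⊢
    exact this
end

section
/- Let d ≥ 4 be an even integer. There exists a constant C = C(d) > 0 such that for every finite field F of odd characteristic and every subset E of the paraboloid P ⊆ F^d, the additive energy Λ(E) = #{(x,y,z,w) ∈ E⁴ : x + y = z + w} satisfies Λ(E) ≤ C (|F|^{-1} |E|³ + |F|^{(d-2)/2} |E|²). -/
open Finset

/-- Second-moment incidence bound: if the fibres of `R` have density `1 / q` in `Y` and distinct
fibres meet in density at most `1 / q ^ 2`, then `R` has few incidences between `Z` and `B`. -/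
lemma sum_incidences_le_of_almost_independent {X Y : Type*} [Fintype Y] [DecidableEq X]
    (R : X → Y → Prop) [∀ x y, Decidable (R x y)] (Z : Finset X) (B : Finset Y) {q N : ℝ}
    (hq : 1 ≤ q) (hN : (Fintype.card Y : ℝ) = N)
    (h₁ : ∀ z ∈ Z, q * (#{y | R z y} : ℝ) = N)
    (h₂ : ∀ z ∈ Z, ∀ z' ∈ Z, z ≠ z' → q ^ 2 * (#{y | R z y ∧ R z' y} : ℝ) ≤ N) :
    ∑ z ∈ Z, (#{y ∈ B | R z y} : ℝ) ≤ #Z * #B / q + √(#Z * #B * N / q) := by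
  have hq0 : 0 < q := by linarith
  have hN0 : 0 ≤ N := hN ▸ Nat.cast_nonneg _
  set r : X → Y → ℝ := fun z y => if R z y then 1 else 0 with hr
  have e₁ (z) (hz : z ∈ Z) : q * ∑ y, r z y = N := by
    rw [← h₁ z hz]; simp [hr]
  have e₂ (z z') : ∑ y, r z y * r z' y = (#{y | R z y ∧ R z' y} : ℝ) := by
    simp only [hr, ← ite_and, ite_mul, one_mul, zero_mul, sum_boole]
  have pair (z) (hz : z ∈ Z) (z') (hz' : z' ∈ Z) :
      ∑ y, (q * r z y - 1) * (q * r z' y - 1) ≤ if z = z' then N * q else 0 := by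
    have expand : ∑ y, (q * r z y - 1) * (q * r z' y - 1) =
        q ^ 2 * ∑ y, r z y * r z' y - q * ∑ y, r z y - q * ∑ y, r z' y + N := by
      rw [← hN, ← Finset.card_univ]
      simp only [mul_sum, ← sum_sub_distrib, cast_card, ← sum_add_distrib]
      exact sum_congr rfl fun _ _ => by ring
    rw [expand, e₁ z hz, e₁ z' hz']
    split_ifs with h
    · subst h
      have : ∑ y, r z y * r z y = ∑ y, r z y := sum_congr rfl fun y _ => by simp [hr]
      rw [this, sq, mul_assoc, e₁ z hz]
      linarith
    · rw [e₂]
      linarith [h₂ z hz z' hz' h]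
  have moment : ∑ y, (∑ z ∈ Z, (q * r z y - 1)) ^ 2 ≤ #Z * (N * q) := by
    calc ∑ y, (∑ z ∈ Z, (q * r z y - 1)) ^ 2
        = ∑ z ∈ Z, ∑ z' ∈ Z, ∑ y, (q * r z y - 1) * (q * r z' y - 1) := by
          simp only [sq, sum_mul_sum]
          rw [sum_comm]
          exact sum_congr rfl fun z _ => sum_comm
      _ ≤ ∑ z ∈ Z, ∑ z' ∈ Z, if z = z' then N * q else 0 :=
          sum_le_sum fun z hz => sum_le_sum fun z' hz' => pair z hz z' hz'
      _ = #Z * (N * q) := by simp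
  have cs : (∑ y ∈ B, ∑ z ∈ Z, (q * r z y - 1)) ^ 2 ≤ #B * (#Z * (N * q)) :=
    calc _ ≤ #B * ∑ y ∈ B, (∑ z ∈ Z, (q * r z y - 1)) ^ 2 := sq_sum_le_card_mul_sum_sq
      _ ≤ #B * ∑ y, (∑ z ∈ Z, (q * r z y - 1)) ^ 2 := by
          gcongr
          exact subset_univ _
      _ ≤ _ := by gcongr
  have total : ∑ y ∈ B, ∑ z ∈ Z, (q * r z y - 1) =
      q * ∑ z ∈ Z, (#{y ∈ B | R z y} : ℝ) - #Z * #B := by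
    rw [sum_comm]
    simp only [sum_sub_distrib, ← mul_sum, hr, sum_boole, sum_const, nsmul_eq_mul, mul_one]
  rw [total] at cs
  have key := Real.le_sqrt_of_sq_le cs
  have : √(#B * (#Z * (N * q))) = q * √(#Z * #B * N / q) := by
    rw [show (#B * (#Z * (N * q)) : ℝ) = q ^ 2 * (#Z * #B * N / q) by field_simp,
      Real.sqrt_mul (sq_nonneg q), Real.sqrt_sq hq0.le]
  rw [this] at key
  have : (#Z * #B / q : ℝ) * q = #Z * #B := by field_simp
  nlinarith

/-- A set stable under translation by `w` is equidistributed over the values of a function that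
moves at unit speed along `w`. -/
lemma card_mul_card_filter_eq_of_translation {F V : Type*} [Field F] [Fintype F] [DecidableEq F]
    [AddCommGroup V] [Module F V] (S : Finset V) (g : V → F) (w : V)
    (hS : ∀ y ∈ S, ∀ c : F, y + c • w ∈ S) (hg : ∀ y, ∀ c : F, g (y + c • w) = g y + c) (b : F) :
    Fintype.card F * #{y ∈ S | g y = b} = #S := by
  have h (b' : F) : #{y ∈ S | g y = b'} = #{y ∈ S | g y = b} := by
    refine card_nbij' (fun y => y + (b - b') • w) (fun y => y + (b' - b) • w) ?_ ?_ ?_ ?_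
    · intro y hy
      simp_all
    · intro y hy
      simp_all
    · intro y _
      simp only [add_assoc, ← add_smul]
      simp
    · intro y _
      simp only [add_assoc, ← add_smul]
      simp
  rw [card_eq_sum_card_fiberwise (s := S) (f := g) (t := univ) (by simp)]
  simp [h]

section Hyperplanes

variable {F ι : Type*} [Field F] [Fintype F] [DecidableEq F] [Fintype ι] [DecidableEq ι]

lemma card_mul_card_hyperplane {u : ι → F} (hu : u ≠ 0) (a : F) :
    Fintype.card F * #{y : ι → F | u ⬝ᵥ y = a} = Fintype.card F ^ Fintype.card ι := by
  obtain ⟨i, hi⟩ := Function.ne_iff.1 hu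
  rw [card_mul_card_filter_eq_of_translation univ (u ⬝ᵥ ·) (Pi.single i (u i)⁻¹) (by simp) ?_ a]
  · simp
  · intro y c
    have : u i ≠ 0 := hi
    simp [dotProduct_add, dotProduct_smul, this]

lemma card_sq_mul_card_hyperplane_inter {u u' : ι → F} (hu : u ⬝ᵥ u ≠ 0)
    (h : ∀ c : F, u' ≠ c • u) (a b : F) :
    Fintype.card F ^ 2 * #{y : ι → F | u ⬝ᵥ y = a ∧ u' ⬝ᵥ y = b} =
      Fintype.card F ^ Fintype.card ι := by
  have hu0 : u ≠ 0 := by rintro rfl; simp at hu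
  obtain ⟨w, hw, hw'⟩ : ∃ w, u ⬝ᵥ w = 0 ∧ u' ⬝ᵥ w = 1 := by
    set v := u' - ((u ⬝ᵥ u') / (u ⬝ᵥ u)) • u with hv
    have hv0 : v ≠ 0 := fun h0 => h _ (sub_eq_zero.1 h0)
    have huv : u ⬝ᵥ v = 0 := by
      rw [hv, dotProduct_sub, dotProduct_smul, smul_eq_mul, div_mul_cancel₀ _ hu, sub_self]
    obtain ⟨i, hi⟩ := Function.ne_iff.1 hv0
    have hi : v i ≠ 0 := hi
    set e : ι → F := Pi.single i (v i)⁻¹ with he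
    have hve : v ⬝ᵥ e = 1 := by simp [he, hi]
    have hue : u ⬝ᵥ (e - ((u ⬝ᵥ e) / (u ⬝ᵥ u)) • u) = 0 := by
      rw [dotProduct_sub, dotProduct_smul, smul_eq_mul, div_mul_cancel₀ _ hu, sub_self]
    refine ⟨_, hue, ?_⟩
    have hu' : u' = v + ((u ⬝ᵥ u') / (u ⬝ᵥ u)) • u := by simp [hv]
    rw [hu', add_dotProduct, smul_dotProduct, hue, smul_zero, add_zero, dotProduct_sub,
      dotProduct_smul, dotProduct_comm v u, huv, hve]
    simp
  rw [sq, mul_assoc, ← filter_filter,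
    card_mul_card_filter_eq_of_translation _ (u' ⬝ᵥ ·) w ?_ ?_ b, card_mul_card_hyperplane hu0]
  · intro y hy c
    simpa [dotProduct_add, dotProduct_smul, hw] using hy
  · intro y c
    simp [dotProduct_add, dotProduct_smul, hw']

/-- Few right angles `x z y` at `z` with given `x` and non-isotropic side `x z`. -/
lemma sum_card_right_angles_le (A : Finset (ι → F)) (x : ι → F) {m : ℕ}
    (hm : Fintype.card ι = 2 * m + 1) :
    ∑ z ∈ A with (x - z) ⬝ᵥ (x - z) ≠ 0, (#{y ∈ A | (x - z) ⬝ᵥ (y - z) = 0} : ℝ) ≤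
      (#A : ℝ) ^ 2 / Fintype.card F + (Fintype.card F : ℝ) ^ m * #A := by
  set q : ℝ := (Fintype.card F : ℝ) with hq
  have hq1 : 1 ≤ q := Nat.one_le_cast.2 Fintype.card_pos
  set Z := {z ∈ A | (x - z) ⬝ᵥ (x - z) ≠ 0} with hZ
  have hZA : (#Z : ℝ) ≤ #A := by exact_mod_cast card_filter_le _ _
  have hnz {z} (hz : z ∈ Z) : (x - z) ⬝ᵥ (x - z) ≠ 0 := (mem_filter.1 hz).2
  have hplane (z y : ι → F) :
      (x - z) ⬝ᵥ (y - z) = 0 ↔ (x - z) ⬝ᵥ y = (x - z) ⬝ᵥ z := by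
    rw [dotProduct_sub, sub_eq_zero]
  have key := sum_incidences_le_of_almost_independent
    (fun z y : ι → F => (x - z) ⬝ᵥ (y - z) = 0) Z A (q := q) (N := q ^ (2 * m + 1)) hq1
    (by simp [hq, hm]) ?_ ?_
  · refine key.trans ?_
    have h₁ : (#Z * #A / q : ℝ) ≤ (#A : ℝ) ^ 2 / q := by
      rw [sq]; gcongr
    have h₂ : √(#Z * #A * q ^ (2 * m + 1) / q) ≤ q ^ m * #A := by
      apply Real.sqrt_le_iff.2 ⟨by positivity, ?_⟩
      rw [pow_succ, ← mul_assoc, mul_div_assoc, div_self (by positivity), mul_one, mul_pow,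
        ← pow_mul, mul_comm m 2, mul_comm (q ^ _), sq]
      gcongr
    linarith
  · intro z hz
    simp_rw [hplane]
    have hu0 : x - z ≠ 0 := by intro h; simpa [h] using hnz hz
    rw [← hm, hq]
    exact_mod_cast card_mul_card_hyperplane hu0 _
  · intro z hz z' hz' hne
    simp_rw [hplane]
    by_cases h : ∃ c : F, x - z' = c • (x - z)
    · obtain ⟨c, hc⟩ := h
      have hc0 : c ≠ 0 := by rintro rfl; exact hnz hz' (by simp [hc])
      have : #{y | (x - z) ⬝ᵥ y = (x - z) ⬝ᵥ z ∧ (x - z') ⬝ᵥ y = (x - z') ⬝ᵥ z'} = 0 := by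
        rw [card_eq_zero, filter_eq_empty_iff]
        rintro y - ⟨h₁, h₂⟩
        rw [hc, smul_dotProduct, smul_dotProduct, h₁, smul_eq_mul, smul_eq_mul,
          mul_right_inj' hc0, ← sub_eq_zero, ← dotProduct_sub,
          show z - z' = (c - 1) • (x - z) by rw [sub_smul, ← hc, one_smul]; abel,
          dotProduct_smul, smul_eq_mul, mul_eq_zero, or_iff_left (hnz hz), sub_eq_zero] at h₂
        rw [h₂, one_smul, sub_right_inj] at hc
        exact hne hc.symm
      rw [this]
      simp only [CharP.cast_eq_zero, mul_zero]
      positivity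
    · push Not at h
      rw [← hm, hq]
      exact_mod_cast (card_sq_mul_card_hyperplane_inter (hnz hz) h _ _).le

end Hyperplanes

lemma addChar_map_sum {A M κ : Type*} [AddCommMonoid A] [CommMonoid M] (ψ : AddChar A M)
    (s : Finset κ) (f : κ → A) : ψ (∑ i ∈ s, f i) = ∏ i ∈ s, ψ (f i) := by
  induction s using Finset.cons_induction <;> simp [*, AddChar.map_add_eq_mul]

section Characters

variable {F : Type*} [Field F] [Fintype F] [DecidableEq F]

/-- The quadratic character of a finite field with values in `ℂ`. -/
noncomputable def complexQuadraticChar (F : Type*) [Field F] [Fintype F] [DecidableEq F] :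
    MulChar F ℂ :=
  (quadraticChar F).ringHomComp (Int.castRingHom ℂ)

local notation "χ" => complexQuadraticChar F

lemma complexQuadraticChar_isQuadratic : (χ).IsQuadratic :=
  (quadraticChar_isQuadratic F).comp _

lemma complexQuadraticChar_ne_one (hF : ringChar F ≠ 2) : χ ≠ 1 :=
  (MulChar.ringHomComp_ne_one_iff (RingHom.injective_int _)).2 (quadraticChar_ne_one hF)

lemma complexQuadraticChar_sq {a : F} (ha : a ≠ 0) : χ a ^ 2 = 1 := by
  simp only [complexQuadraticChar, MulChar.ringHomComp_apply, ← map_pow, quadraticChar_sq_one ha,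
    map_one]

lemma norm_complexQuadraticChar_le (a : F) : ‖χ a‖ ≤ 1 := by
  rcases complexQuadraticChar_isQuadratic a with h | h | h <;> simp [h]

variable {ψ : AddChar F ℂ}

lemma norm_gaussSum_complexQuadraticChar_sq (hF : ringChar F ≠ 2) (hψ : ψ.IsPrimitive) :
    ‖gaussSum χ ψ‖ ^ 2 = Fintype.card F := by
  have h := gaussSum_mul_gaussSum_eq_card (complexQuadraticChar_ne_one hF) hψ
  rw [← star_gaussSum_eq, ← starRingEnd_apply, Complex.mul_conj'] at h
  exact_mod_cast h

lemma sum_complexQuadraticChar_mul (hF : ringChar F ≠ 2) (a : F) :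
    ∑ b, χ b * ψ (a * b) = χ a * gaussSum χ ψ := by
  rcases eq_or_ne a 0 with rfl | ha
  · simp [MulChar.sum_eq_zero_of_ne_one (complexQuadraticChar_ne_one hF), MulChar.map_zero]
  · have h := gaussSum_mulShift_eq χ ψ (Units.mk0 a ha)
    rwa [complexQuadraticChar_isQuadratic.inv] at h

lemma sum_addChar_mul_sq (hF : ringChar F ≠ 2) (hψ : ψ.IsPrimitive) {a : F} (ha : a ≠ 0) :
    ∑ u, ψ (a * (u * u)) = χ a * gaussSum χ ψ := by
  have card (b : F) : (#{u : F | u * u = b} : ℂ) = χ b + 1 := by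
    have h := quadraticChar_card_sqrts hF b
    rw [show {x : F | x ^ 2 = b}.toFinset = ({u : F | u * u = b} : Finset F) by
      ext; simp [sq]] at h
    simp only [complexQuadraticChar, MulChar.ringHomComp_apply, eq_intCast]
    exact_mod_cast congrArg (Int.cast : ℤ → ℂ) h
  have h₀ : ∑ b, ψ (a * b) = 0 := by
    simpa [ha, mul_comm] using AddChar.sum_mulShift a hψ
  calc ∑ u, ψ (a * (u * u)) = ∑ b, ∑ u with u * u = b, ψ (a * (u * u)) :=
        (sum_fiberwise _ _ _).symm
    _ = ∑ b, (χ b + 1) * ψ (a * b) := by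
        refine sum_congr rfl fun b _ => ?_
        rw [← card, sum_congr rfl (g := fun _ => ψ (a * b)), sum_const, nsmul_eq_mul]
        intro u hu
        rw [(mem_filter.1 hu).2]
    _ = χ a * gaussSum χ ψ := by
        simp [add_mul, sum_add_distrib, h₀, sum_complexQuadraticChar_mul hF]

variable {ι : Type*} [Fintype ι] [DecidableEq ι]

lemma sum_addChar_dotProduct (hψ : ψ.IsPrimitive) (v : ι → F) :
    ∑ ξ : ι → F, ψ (ξ ⬝ᵥ v) = if v = 0 then (Fintype.card F : ℂ) ^ Fintype.card ι else 0 := by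
  simp only [dotProduct, addChar_map_sum]
  rw [← Fintype.prod_sum (fun i (x : F) => ψ (x * v i))]
  simp only [AddChar.sum_mulShift _ hψ]
  split_ifs with h
  · simp [h]
  · obtain ⟨i, hi⟩ := Function.ne_iff.1 h
    exact prod_eq_zero (mem_univ i) (by simpa using hi)

lemma sum_addChar_quadratic (hF : ringChar F ≠ 2) (hψ : ψ.IsPrimitive) {a : F} (ha : a ≠ 0)
    (v : ι → F) :
    ∑ ξ : ι → F, ψ (a * (ξ ⬝ᵥ ξ) + ξ ⬝ᵥ v) =
      (χ a * gaussSum χ ψ) ^ Fintype.card ι * ψ (-(4 * a)⁻¹ * (v ⬝ᵥ v)) := by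
  have h2 : (2 : F) ≠ 0 := Ring.two_ne_zero hF
  have h4 : (4 : F) ≠ 0 := by rw [show (4 : F) = 2 * 2 by norm_num]; exact mul_ne_zero h2 h2
  rw [← Equiv.sum_comp (Equiv.subRight ((2 * a)⁻¹ • v))]
  have shift (ξ : ι → F) : a * ((ξ - (2 * a)⁻¹ • v) ⬝ᵥ (ξ - (2 * a)⁻¹ • v)) +
      (ξ - (2 * a)⁻¹ • v) ⬝ᵥ v = ∑ i, a * (ξ i * ξ i) + -(4 * a)⁻¹ * (v ⬝ᵥ v) := by
    rw [← mul_sum]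
    change _ = a * (ξ ⬝ᵥ ξ) + _
    simp only [sub_dotProduct, dotProduct_sub, smul_dotProduct, dotProduct_smul, smul_eq_mul,
      dotProduct_comm v ξ]
    field_simp
    ring
  simp only [Equiv.subRight_apply, shift, AddChar.map_add_eq_mul, ← sum_mul,
    addChar_map_sum]
  rw [← Fintype.prod_sum (fun _ (x : F) => ψ (a * (x * x)))]
  simp [sum_addChar_mul_sq hF hψ ha]

/-- In odd dimension, few pairs of points of `A` are at distance zero from each other. -/
lemma card_null_pairs_le (hF : ringChar F ≠ 2) (A : Finset (ι → F)) {m : ℕ}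
    (hm : Fintype.card ι = 2 * m + 1) :
    ∑ x ∈ A, (#{z ∈ A | (x - z) ⬝ᵥ (x - z) = 0} : ℝ) ≤
      (#A : ℝ) ^ 2 / Fintype.card F + (Fintype.card F : ℝ) ^ m * #A := by
  obtain ⟨ψ, hψ₁⟩ := (AddChar.exists_apply_ne_zero (α := F) (a := 1)).2 one_ne_zero
  have hψ : ψ.IsPrimitive := AddChar.IsPrimitive.of_ne_one (by rintro rfl; simp at hψ₁)
  set q : ℝ := (Fintype.card F : ℝ) with hq
  have hq0 : 0 < q := Nat.cast_pos.2 Fintype.card_pos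
  set n := Fintype.card ι
  set g := gaussSum χ ψ
  have hg : ‖g‖ ^ 2 = q := norm_gaussSum_complexQuadraticChar_sq hF hψ
  have hg0 : 0 < ‖g‖ := by
    have := norm_nonneg g
    by_contra h
    have : ‖g‖ = 0 := by linarith
    rw [this] at hg
    simp [← hg] at hq0
  set D : (ι → F) → (ι → F) → F := fun x z => (x - z) ⬝ᵥ (x - z) with hD
  set M := ∑ x ∈ A, (#{z ∈ A | D x z = 0} : ℝ) with hM
  set P : (ι → F) → ℝ := fun ξ => ‖∑ x ∈ A, ψ (ξ ⬝ᵥ x)‖ ^ 2 with hP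
  have hPC (ξ : ι → F) : (P ξ : ℂ) = ∑ x ∈ A, ∑ z ∈ A, ψ (ξ ⬝ᵥ (x - z)) := by
    rw [hP]
    push_cast
    rw [← Complex.mul_conj', map_sum, sum_mul_sum]
    simp only [← AddChar.map_neg_eq_conj, ← AddChar.map_add_eq_mul, dotProduct_add,
      dotProduct_neg, sub_eq_add_neg]
  have parseval : ∑ ξ, P ξ = q ^ n * #A := by
    have : ∑ ξ, (P ξ : ℂ) = q ^ n * #A := by
      simp only [hPC]
      rw [sum_comm]
      simp_rw [sum_comm (s := univ) (t := A), sum_addChar_dotProduct hψ, sub_eq_zero]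
      simp [hq, mul_comm, n]
    exact_mod_cast this
  set S : ℂ := ∑ s ∈ univ.erase (0 : F), ∑ x ∈ A, ∑ z ∈ A, ψ (s * D x z) with hS
  have hMS : (q * M : ℂ) = #A ^ 2 + S := by
    have h₁ : (q * M : ℂ) = ∑ s : F, ∑ x ∈ A, ∑ z ∈ A, ψ (s * D x z) := by
      rw [sum_comm]
      simp_rw [sum_comm (s := univ) (t := A), AddChar.sum_mulShift _ hψ]
      simp [hq, hM, mul_sum, mul_comm, sum_ite]
    rw [h₁, hS, ← add_sum_erase _ _ (mem_univ (0 : F))]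
    simp [sq]
  have dual : g ^ n * S = ∑ ξ, P ξ * ∑ a, χ a * ψ ((ξ ⬝ᵥ ξ) * a) := by
    have h4 : (4 : F) ≠ 0 := by
      rw [show (4 : F) = 2 * 2 by norm_num]
      exact mul_ne_zero (Ring.two_ne_zero hF) (Ring.two_ne_zero hF)
    have fibre (a : F) (ha : a ≠ 0) : χ a * ∑ ξ, P ξ * ψ ((ξ ⬝ᵥ ξ) * a) =
        g ^ n * ∑ x ∈ A, ∑ z ∈ A, ψ (-(4 * a)⁻¹ * D x z) := by
      have hχ : χ a * χ a ^ n = 1 := by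
        rw [← pow_succ', show n + 1 = 2 * (m + 1) by omega, pow_mul, complexQuadraticChar_sq ha,
          one_pow]
      have : ∑ ξ, P ξ * ψ ((ξ ⬝ᵥ ξ) * a) =
          ∑ x ∈ A, ∑ z ∈ A, ∑ ξ, ψ (a * (ξ ⬝ᵥ ξ) + ξ ⬝ᵥ (x - z)) := by
        simp only [hPC, sum_mul, ← AddChar.map_add_eq_mul]
        rw [sum_comm]
        simp_rw [sum_comm (s := univ) (t := A), mul_comm a, add_comm]
      rw [this]
      simp only [sum_addChar_quadratic hF hψ ha, ← mul_sum, mul_pow]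
      rw [← mul_assoc, ← mul_assoc, hχ, one_mul]
    symm
    calc ∑ ξ, P ξ * ∑ a, χ a * ψ ((ξ ⬝ᵥ ξ) * a)
        = ∑ a, χ a * ∑ ξ, P ξ * ψ ((ξ ⬝ᵥ ξ) * a) := by
          simp only [mul_sum]
          rw [sum_comm]
          exact sum_congr rfl fun _ _ => sum_congr rfl fun _ _ => by ring
      _ = ∑ a ∈ univ.erase 0, g ^ n * ∑ x ∈ A, ∑ z ∈ A, ψ (-(4 * a)⁻¹ * D x z) := by
          rw [← add_sum_erase _ _ (mem_univ (0 : F)), MulChar.map_zero, zero_mul, zero_add]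
          exact sum_congr rfl fun a ha => fibre a (ne_of_mem_erase ha)
      _ = g ^ n * S := by
          rw [← mul_sum, hS]
          congr 1
          refine sum_nbij' (fun a => -(4 * a)⁻¹) (fun a => -(4 * a)⁻¹) ?_ ?_ ?_ ?_ ?_
          · intro a ha
            simpa [h4] using ha
          · intro a ha
            simpa [h4] using ha
          · intro a ha
            have := ne_of_mem_erase ha
            field_simp
          · intro a ha
            have := ne_of_mem_erase ha
            field_simp
          · intro a _
            rfl
  have bound : ‖g‖ ^ n * ‖S‖ ≤ ‖g‖ * (q ^ n * #A) := by
    rw [← norm_pow, ← norm_mul, dual, ← parseval, mul_sum]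
    refine norm_sum_le_of_le _ fun ξ _ => ?_
    have hP0 : 0 ≤ P ξ := sq_nonneg _
    rw [sum_complexQuadraticChar_mul hF, norm_mul, norm_mul, Complex.norm_real,
      Real.norm_of_nonneg hP0, mul_comm]
    gcongr
    exact mul_le_of_le_one_left (norm_nonneg _) (norm_complexQuadraticChar_le _)
  have hS_le : ‖S‖ ≤ q ^ (m + 1) * #A := by
    rw [hm, pow_succ ‖g‖, pow_mul, hg, mul_comm (q ^ m), mul_assoc] at bound
    have := le_of_mul_le_mul_left bound hg0
    refine le_of_mul_le_mul_left (this.trans_eq ?_) (pow_pos hq0 m)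
    ring
  have hqM : q * M ≤ #A ^ 2 + q ^ (m + 1) * #A := by
    have hnorm := congrArg norm hMS
    rw [← Complex.ofReal_mul, Complex.norm_real] at hnorm
    calc q * M ≤ ‖q * M‖ := Real.le_norm_self _
      _ ≤ ‖(#A ^ 2 : ℂ)‖ + ‖S‖ := hnorm ▸ norm_add_le _ _
      _ ≤ #A ^ 2 + q ^ (m + 1) * #A := by simpa using hS_le
  refine le_of_mul_le_mul_left (hqM.trans_eq ?_) hq0
  field_simp
  ring

end Characters

/-- In odd dimension, a set contains few right angles. -/
lemma sum_sum_card_right_angles_le {F ι : Type*} [Field F] [Fintype F] [DecidableEq F]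
    [Fintype ι] [DecidableEq ι] (hF : ringChar F ≠ 2) (A : Finset (ι → F)) {m : ℕ}
    (hm : Fintype.card ι = 2 * m + 1) :
    ∑ x ∈ A, ∑ z ∈ A, (#{y ∈ A | (x - z) ⬝ᵥ (y - z) = 0} : ℝ) ≤
      2 * ((Fintype.card F : ℝ)⁻¹ * (#A : ℝ) ^ 3 + (Fintype.card F : ℝ) ^ m * (#A : ℝ) ^ 2) := by
  have isotropic : ∑ x ∈ A, ∑ z ∈ A with (x - z) ⬝ᵥ (x - z) = 0,
      (#{y ∈ A | (x - z) ⬝ᵥ (y - z) = 0} : ℝ) ≤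
        ((#A : ℝ) ^ 2 / Fintype.card F + (Fintype.card F : ℝ) ^ m * #A) * #A := by
    refine le_trans ?_ (mul_le_mul_of_nonneg_right (card_null_pairs_le hF A hm)
      (Nat.cast_nonneg #A))
    rw [sum_mul]
    refine sum_le_sum fun x _ => ?_
    rw [← nsmul_eq_mul]
    exact sum_le_card_nsmul _ _ _ fun z _ => by exact_mod_cast card_filter_le _ _
  have anisotropic := sum_le_card_nsmul A _ _ fun x _ => sum_card_right_angles_le A x hm
  rw [nsmul_eq_mul] at anisotropic
  calc _ = _ := sum_congr rfl fun x _ =>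
        (sum_filter_add_sum_filter_not A (fun z => (x - z) ⬝ᵥ (x - z) = 0) _).symm
    _ ≤ _ := sum_add_distrib.trans_le (add_le_add isotropic anisotropic)
    _ = _ := by ring

/-- The energy of a subset of the paraboloid is at most the number of right angles in its
projection. -/
lemma card_energy_le_sum_card_right_angles {F ι : Type*} [Field F] [DecidableEq F] [Fintype ι]
    (hF : ringChar F ≠ 2) (E : Finset ((ι → F) × F)) (hE : ∀ p ∈ E, p.2 = p.1 ⬝ᵥ p.1) :
    #{q ∈ (E ×ˢ E) ×ˢ (E ×ˢ E) | q.1.1 + q.1.2 = q.2.1 + q.2.2} ≤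
      ∑ x ∈ E.image Prod.fst, ∑ z ∈ E.image Prod.fst,
        #{y ∈ E.image Prod.fst | (x - z) ⬝ᵥ (y - z) = 0} := by
  set A := E.image Prod.fst with hA
  have hT : ∑ x ∈ A, ∑ z ∈ A, #{y ∈ A | (x - z) ⬝ᵥ (y - z) = 0} =
      #{t ∈ A ×ˢ A ×ˢ A | (t.1 - t.2.1) ⬝ᵥ (t.2.2 - t.2.1) = 0} := by
    simp only [card_filter, sum_product]
  rw [hT]
  refine card_le_card_of_injOn (fun q => (q.1.1.1, q.2.1.1, q.1.2.1)) ?_ ?_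
  · rintro ⟨⟨x, y⟩, z, w⟩ hq
    simp only [coe_filter, mem_product, Set.mem_ofPred_eq] at hq ⊢
    obtain ⟨⟨⟨hx, hy⟩, hz, hw⟩, h⟩ := hq
    refine ⟨⟨mem_image_of_mem _ hx, mem_image_of_mem _ hz, mem_image_of_mem _ hy⟩, ?_⟩
    have h₁ : w.1 = x.1 + y.1 - z.1 := by
      rw [← Prod.fst_add, h, Prod.fst_add, add_sub_cancel_left]
    have h₂ := congrArg Prod.snd h
    rw [Prod.snd_add, Prod.snd_add, hE _ hx, hE _ hy, hE _ hz, hE _ hw, h₁] at h₂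
    have h2 : (2 : F) * ((x.1 - z.1) ⬝ᵥ (y.1 - z.1)) = 0 := by
      simp only [dotProduct_sub, sub_dotProduct, dotProduct_add, add_dotProduct,
        dotProduct_comm y.1 x.1, dotProduct_comm z.1 x.1, dotProduct_comm z.1 y.1] at h₂ ⊢
      linear_combination -h₂
    exact (mul_eq_zero.1 h2).resolve_left (Ring.two_ne_zero hF)
  · rintro ⟨⟨x, y⟩, z, w⟩ hq ⟨⟨x', y'⟩, z', w'⟩ hq' heq
    simp only [coe_filter, mem_product, Set.mem_ofPred_eq, Prod.mk.injEq] at hq hq' heq ⊢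
    obtain ⟨⟨⟨hx, hy⟩, hz, -⟩, h⟩ := hq
    obtain ⟨⟨⟨hx', hy'⟩, hz', -⟩, h'⟩ := hq'
    have inj {p p' : (ι → F) × F} (hp : p ∈ E) (hp' : p' ∈ E) (h : p.1 = p'.1) : p = p' :=
      Prod.ext h (by rw [hE _ hp, hE _ hp', h])
    obtain rfl := inj hx hx' heq.1
    obtain rfl := inj hz hz' heq.2.1
    obtain rfl := inj hy hy' heq.2.2
    exact ⟨⟨rfl, rfl⟩, rfl, add_left_cancel (h.symm.trans h')⟩

/-- For every even `d ≥ 4` there is a constant `C = C(d) > 0` such that for every finite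
field `F` of odd characteristic and every subset `E` of the paraboloid
`P = {(x̄, x̄·x̄) : x̄ ∈ F^{d-1}} ⊆ F^d` (points of `F^d` modeled as pairs `(x̄, x_d)`),
the additive energy `Λ(E) = #{(x,y,z,w) ∈ E⁴ : x + y = z + w}` satisfies
`Λ(E) ≤ C (|F|⁻¹ |E|³ + |F|^{(d-2)/2} |E|²)`. -/
theorem stmt3 (d : ℕ) (hd : 4 ≤ d) (hdeven : Even d) :
    ∃ C : ℝ, 0 < C ∧
      ∀ (F : Type) [Field F] [Fintype F] [DecidableEq F], ringChar F ≠ 2 →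
      ∀ E : Finset ((Fin (d - 1) → F) × F),
        (∀ p ∈ E, p.2 = ∑ i, p.1 i * p.1 i) →
        (((((E ×ˢ E) ×ˢ (E ×ˢ E)).filter
              (fun q => q.1.1 + q.1.2 = q.2.1 + q.2.2)).card : ℝ))
          ≤ C * ((Fintype.card F : ℝ)⁻¹ * (E.card : ℝ) ^ 3 +
              (Fintype.card F : ℝ) ^ (((d : ℝ) - 2) / 2) * (E.card : ℝ) ^ 2) := by
  obtain ⟨k, rfl⟩ := hdeven
  refine ⟨2, two_pos, fun F _ _ _ hF E hE => ?_⟩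
  have hm : Fintype.card (Fin (k + k - 1)) = 2 * (k - 1) + 1 := by
    rw [Fintype.card_fin]
    omega
  have hexp : (((k + k : ℕ) : ℝ) - 2) / 2 = ((k - 1 : ℕ) : ℝ) := by
    rw [Nat.cast_sub (by omega)]
    push_cast
    ring
  have hcard : (#(E.image Prod.fst) : ℝ) ≤ #E := by exact_mod_cast card_image_le
  have energy := card_energy_le_sum_card_right_angles hF E hE
  rw [hexp, Real.rpow_natCast]
  refine le_trans ?_ ((sum_sum_card_right_angles_le hF (E.image Prod.fst) hm).trans ?_)
  · exact_mod_cast energy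
  · gcongr
end
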